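/- arXiv:1801.06474 — 13 statements merged into one kernel-verified Lean document; each statement's English description precedes it below -/
import Mathlib

section
/- Let R be a local ring (associative, with identity) whose residue field R/J(R) is a prime field, in the sense that for every r ∈ R there exists an integer n such that r − n·1 lies in the Jacobson radical J(R). If J(R)³ = 0 (the product of any three elements of J(R) is zero), then R is semicommutative: for all a, b ∈ R, ab = 0 implies arb = 0 for every r ∈ R. -/
theorem aux_dedekind {R : Type*} [Ring R] [IsLocalRing R] {x v : R} (h : v * x = 1) :
    IsUnit x := by
  have he : (x * v) * (x * v) = x * v := by
    rw [mul_assoc, ← mul_assoc v, h, one_mul]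
  rcases IsLocalRing.isUnit_or_isUnit_of_add_one (add_sub_cancel (x * v) 1) with hu | hu
  · have h1 : x * v = 1 := hu.mul_left_cancel (by rw [he, mul_one])
    exact ⟨⟨x, v, h1, h⟩, rfl⟩
  · exfalso
    have h0 : x * v = 0 := hu.mul_left_cancel (by rw [sub_mul, he, one_mul, sub_self, mul_zero])
    have : (1 : R) = 0 := by
      calc (1 : R) = v * x * (v * x) := by rw [h, one_mul]
        _ = v * (x * v) * x := by simp only [mul_assoc]
        _ = 0 := by rw [h0, mul_zero, zero_mul]
    exact one_ne_zero this

theorem aux_mem_jacobson {R : Type*} [Ring R] [IsLocalRing R] {x : R} (hx : ¬ IsUnit x) :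
    x ∈ (⊥ : Ideal R).jacobson := by
  rw [Ideal.mem_jacobson_iff]
  intro y
  rcases IsLocalRing.isUnit_or_isUnit_of_add_one (add_sub_cancel (-(y * x)) 1) with hu | hu
  · obtain ⟨w, hw⟩ := hu.exists_left_inv
    exact absurd (aux_dedekind (x := x) (v := -(w * y)) (by
      rw [← hw]; simp only [mul_neg, neg_mul, mul_assoc])) hx
  · obtain ⟨z, hz⟩ := hu.exists_left_inv
    refine ⟨z, ?_⟩
    rw [Ideal.mem_bot, ← hz]
    noncomm_ring

/-- A local ring whose residue field is a prime field and whose Jacobson radical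
cubes to zero is semicommutative. -/
theorem local_prime_residue_J3_zero_semicommutative (R : Type*) [Ring R] [IsLocalRing R]
    (hprime : ∀ r : R, ∃ n : ℤ, r - (n : R) ∈ (⊥ : Ideal R).jacobson)
    (hJ3 : ∀ a b c : R, a ∈ (⊥ : Ideal R).jacobson → b ∈ (⊥ : Ideal R).jacobson →
      c ∈ (⊥ : Ideal R).jacobson → a * b * c = 0) :
    ∀ a b : R, a * b = 0 → ∀ r : R, a * r * b = 0 := by
  intro a b hab r
  by_cases ha : IsUnit a
  · rw [ha.mul_right_eq_zero.mp hab, mul_zero]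
  by_cases hb : IsUnit b
  · rw [hb.mul_left_eq_zero.mp hab, zero_mul, zero_mul]
  obtain ⟨n, hn⟩ := hprime r
  have h := hJ3 a _ b (aux_mem_jacobson ha) hn (aux_mem_jacobson hb)
  rw [mul_sub, sub_mul, sub_eq_zero] at h
  rw [h, ← Int.cast_comm, mul_assoc, hab, mul_zero]
end

section
/- A ring R (associative, with identity) is reversible if and only if it is both semicommutative and reflexive. That is: (for all a, b ∈ R, ab = 0 implies ba = 0) holds if and only if (for all a, b ∈ R, ab = 0 implies arb = 0 for every r ∈ R) and (for all a, b ∈ R, if arb = 0 for every r ∈ R then bra = 0 for every r ∈ R) both hold. -/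
/-- A ring is reversible if and only if it is semicommutative and reflexive. -/
theorem reversible_iff_semicommutative_and_reflexive (R : Type*) [Ring R] :
    (∀ a b : R, a * b = 0 → b * a = 0) ↔
      ((∀ a b : R, a * b = 0 → ∀ r : R, a * r * b = 0) ∧
        (∀ a b : R, (∀ r : R, a * r * b = 0) → ∀ r : R, b * r * a = 0)) := by
  constructor
  · intro h
    refine ⟨fun a b hab r => ?_, fun a b hab r => ?_⟩
    · apply h
      rw [← mul_assoc, h a b hab, zero_mul]
    · have h1 : a * b = 0 := by simpa using hab 1
      rw [mul_assoc]
      apply h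
      rw [mul_assoc, h1, mul_zero]
  · rintro ⟨hs, hr⟩ a b hab
    simpa using hr a b (hs a b hab) 1
end

section
/- A finite ring (associative, with identity) is right duo if and only if it is left duo: every right ideal of a finite ring R is a two-sided ideal if and only if every left ideal of R is a two-sided ideal. -/
/-- Double counting of the pairs `(a, b)` with `f a b = 0`. -/
theorem duo_aux {R : Type*} [AddCommGroup R] [Fintype R] (f g : R → (R →+ R))
    (hfg : ∀ a b, f a b = g b a) (h : ∀ a, (g a).range ≤ (f a).range) (a : R) :
    (g a).range = (f a).range := by
  classical
  have key : ∀ φ : R →+ R, Nat.card φ.ker * Nat.card φ.range = Nat.card R := fun φ => by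
    rw [← AddSubgroup.index_ker, AddSubgroup.card_mul_index]
  have hle : ∀ a, Nat.card (g a).range ≤ Nat.card (f a).range := fun a =>
    AddSubgroup.card_le_of_le (h a)
  have hker : ∀ a, Nat.card (f a).ker ≤ Nat.card (g a).ker := fun a => by
    have h1 := key (f a)
    have h2 := key (g a)
    have h3 : 0 < Nat.card (g a).range := Nat.card_pos
    refine Nat.le_of_mul_le_mul_right ?_ h3
    rw [h2, ← h1]
    exact Nat.mul_le_mul_left _ (hle a)
  have cardker : ∀ φ : R →+ R, Nat.card φ.ker = ∑ b : R, if φ b = 0 then 1 else 0 := fun φ => by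
    rw [← Finset.card_filter, ← Fintype.card_subtype, ← Nat.card_eq_fintype_card]
    rfl
  have hsum : ∑ a, Nat.card (f a).ker = ∑ a, Nat.card (g a).ker := by
    simp only [cardker, hfg]
    exact Finset.sum_comm
  have heq := (Finset.sum_eq_sum_iff_of_le (fun a _ => hker a)).1 hsum a (Finset.mem_univ a)
  have h1 := key (f a)
  have h2 := key (g a)
  have h3 : 0 < Nat.card (g a).ker := Nat.card_pos
  rw [heq, ← h2] at h1
  exact AddSubgroup.eq_of_le_of_card_ge (h a) (Nat.eq_of_mul_eq_mul_left h3 h1).le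

/-- A finite ring is right duo if and only if it is left duo. -/
theorem finite_ring_right_duo_iff_left_duo (R : Type*) [Ring R] [Fintype R] :
    (∀ a b : R, ∃ c : R, b * a = a * c) ↔ (∀ a b : R, ∃ c : R, a * b = c * a) := by
  constructor
  · intro h a b
    have := duo_aux (R := R) AddMonoidHom.mulLeft AddMonoidHom.mulRight (fun _ _ => rfl)
      (by
        rintro a _ ⟨b, rfl⟩
        obtain ⟨c, hc⟩ := h a b
        exact ⟨c, hc.symm⟩) a
    have hm : a * b ∈ (AddMonoidHom.mulLeft a).range := ⟨b, rfl⟩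
    rw [← this] at hm
    obtain ⟨c, hc⟩ := hm
    exact ⟨c, hc.symm⟩
  · intro h a b
    have := duo_aux (R := R) AddMonoidHom.mulRight AddMonoidHom.mulLeft (fun _ _ => rfl)
      (by
        rintro a _ ⟨b, rfl⟩
        obtain ⟨c, hc⟩ := h a b
        exact ⟨c, hc.symm⟩) a
    have hm : b * a ∈ (AddMonoidHom.mulRight a).range := ⟨b, rfl⟩
    rw [← this] at hm
    obtain ⟨c, hc⟩ := hm
    exact ⟨c, hc.symm⟩
end

section
/- Let p be a prime number. Every ring (associative, with identity) with exactly p² elements is commutative. -/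
/-- Every ring of order p² (p prime) is commutative. -/
theorem ring_of_order_p_sq_is_commutative (p : ℕ) (hp : p.Prime)
    (R : Type*) [Ring R] [Fintype R] (hcard : Fintype.card R = p ^ 2) :
    ∀ a b : R, a * b = b * a := by
  intro a b
  by_contra hab
  let C : AddSubgroup R := (Subring.centralizer {a}).toAddSubgroup
  let Z : AddSubgroup R := (Subring.center R).toAddSubgroup
  have memC : ∀ x, x ∈ C ↔ a * x = x * a := by
    intro x
    change x ∈ Subring.centralizer {a} ↔ _
    simp [Subring.mem_centralizer_iff]
  have memZ : ∀ x, x ∈ Z ↔ ∀ g, g * x = x * g := by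
    intro x
    change x ∈ Subring.center R ↔ _
    exact Subring.mem_center_iff
  have hR : Nat.card R = p ^ 2 := by rw [Nat.card_eq_fintype_card, hcard]
  have hZC : Z ≤ C := fun x hx => (memC x).2 ((memZ x).1 hx a)
  have hC : Nat.card C ∣ p ^ 2 := hR ▸ C.card_addSubgroup_dvd_card
  have hZ : Nat.card Z ∣ p ^ 2 := hR ▸ Z.card_addSubgroup_dvd_card
  obtain ⟨i, hi, hCi⟩ := (Nat.dvd_prime_pow hp).1 hC
  obtain ⟨j, hj, hZj⟩ := (Nat.dvd_prime_pow hp).1 hZ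
  have hi2 : i ≠ 2 := by
    rintro rfl
    have h : C = ⊤ := AddSubgroup.eq_top_of_card_eq C (by rw [hCi, hR])
    exact hab ((memC b).1 (h ▸ AddSubgroup.mem_top b))
  have hij : j < i := by
    by_contra hle
    have h : Z = C := AddSubgroup.eq_of_le_of_card_ge hZC (by
      rw [hCi, hZj]; exact Nat.pow_le_pow_right hp.pos (by omega))
    have ha : a ∈ Z := h ▸ (memC a).2 rfl
    exact hab ((memZ a).1 ha b).symm
  have hj0 : j = 0 := by omega
  rw [hj0, pow_zero] at hZj
  have hbot : Z = ⊥ := AddSubgroup.card_eq_one.1 hZj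
  have h1 : (1 : R) ∈ Z := (memZ 1).2 (by simp)
  rw [hbot, AddSubgroup.mem_bot] at h1
  have := subsingleton_of_zero_eq_one h1.symm
  exact hab (Subsingleton.elim _ _)
end

section
/- Let p be a prime number. Every noncommutative ring (associative, with identity) with exactly p³ elements is isomorphic to the ring U₂(F_p) of 2×2 upper triangular matrices over the field with p elements, i.e., to the subring {M ∈ M₂(ZMod p) | M₁₀ = 0} of the full 2×2 matrix ring over ZMod p. -/
/-- The subring U₂(F_p) of upper triangular 2×2 matrices over `ZMod p`. -/
def upperTriangular2 (p : ℕ) : Subring (Matrix (Fin 2) (Fin 2) (ZMod p)) where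
  carrier := {M | M 1 0 = 0}
  zero_mem' := rfl
  one_mem' := by simp [Matrix.one_apply]
  add_mem' := by intro a b ha hb; simp_all [Set.mem_setOf_eq, Matrix.add_apply]
  neg_mem' := by intro a ha; simp_all [Set.mem_setOf_eq, Matrix.neg_apply]
  mul_mem' := by
    intro a b ha hb
    simp only [Set.mem_setOf_eq] at *
    simp [Matrix.mul_apply, Fin.sum_univ_succ, ha, hb]

theorem aux_inj {F R : Type*} [Field F] [Ring R] [Algebra F R] (a b : R) (h : a * b ≠ b * a)
    (x y z : F) (h0 : x • (1:R) + y • a + z • b = 0) : x = 0 ∧ y = 0 ∧ z = 0 := by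
  have e1 : z • (a * b - b * a) = 0 := by
    have h1 : a * (x • (1:R) + y • a + z • b) - (x • (1:R) + y • a + z • b) * a = 0 := by
      rw [h0]; simp
    rw [← h1]
    simp only [mul_add, add_mul, mul_smul_comm, smul_mul_assoc, mul_one, one_mul, smul_sub]
    abel
  have hz : z = 0 := by
    rcases smul_eq_zero.mp e1 with h | h'
    · exact h
    · exact absurd (sub_eq_zero.mp h') h
  have e2 : y • (a * b - b * a) = 0 := by
    have h1 : (x • (1:R) + y • a + z • b) * b - b * (x • (1:R) + y • a + z • b) = 0 := by
      rw [h0]; simp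
    rw [← h1]
    simp only [mul_add, add_mul, mul_smul_comm, smul_mul_assoc, mul_one, one_mul, smul_sub]
    abel
  have hy : y = 0 := by
    rcases smul_eq_zero.mp e2 with h | h'
    · exact h
    · exact absurd (sub_eq_zero.mp h') h
  subst hz hy
  refine ⟨?_, rfl, rfl⟩
  have h3 : x • (1:R) = 0 := by simpa using h0
  rcases smul_eq_zero.mp h3 with h4 | h4
  · exact h4
  · exact absurd (by rw [← mul_one (a*b), ← mul_one (b*a), h4]; simp) h

theorem aux_span {F R : Type*} [Field F] [Fintype F] [Ring R] [Fintype R] [Algebra F R]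
    (hc : Fintype.card R = Fintype.card F ^ 3) (a b : R) (h : a * b ≠ b * a) (r : R) :
    ∃ x y z : F, r = x • (1:R) + y • a + z • b := by
  let f : F × F × F → R := fun t => t.1 • (1:R) + t.2.1 • a + t.2.2 • b
  have hf : Function.Injective f := by
    rintro ⟨x, y, z⟩ ⟨x', y', z'⟩ hh
    have := aux_inj a b h (x - x') (y - y') (z - z') (by
      have h2 := sub_eq_zero.mpr hh
      simp only [f] at h2
      rw [← h2]
      simp only [sub_smul]; abel)
    obtain ⟨h1, h2, h3⟩ := this
    rw [sub_eq_zero.mp h1, sub_eq_zero.mp h2, sub_eq_zero.mp h3]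
  have hb : Function.Bijective f := by
    rw [Fintype.bijective_iff_injective_and_card]
    refine ⟨hf, ?_⟩
    simp only [Fintype.card_prod, hc]; ring
  obtain ⟨⟨x, y, z⟩, ht⟩ := hb.2 r
  exact ⟨x, y, z, ht.symm⟩

theorem aux_sq {F R : Type*} [Field F] [Fintype F] [Ring R] [Fintype R] [Algebra F R]
    (hc : Fintype.card R = Fintype.card F ^ 3) (a b : R) (h : a * b ≠ b * a) :
    ∃ x y : F, a * a = x • (1:R) + y • a := by
  obtain ⟨x, y, z, ht⟩ := aux_span (F := F) hc a b h (a * a)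
  refine ⟨x, y, ?_⟩
  have e1 : z • (a * b - b * a) = 0 := by
    have h1 : a * (x • (1:R) + y • a + z • b) - (x • (1:R) + y • a + z • b) * a = 0 := by
      rw [← ht]; simp [mul_assoc]
    rw [← h1]
    simp only [mul_add, add_mul, mul_smul_comm, smul_mul_assoc, mul_one, one_mul, smul_sub]
    abel
  rcases smul_eq_zero.mp e1 with h5 | h'
  · rw [ht, h5]; simp
  · exact absurd (sub_eq_zero.mp h') h

theorem aux_zero {F R : Type*} [Field F] [Fintype F] [Ring R] [Fintype R] [Algebra F R]
    (hc : Fintype.card R = Fintype.card F ^ 3) (a b : R) (h : a * b ≠ b * a) :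
    ∃ a b : R, a * b = 0 ∧ b * a ≠ 0 := by
  obtain ⟨x, y, z, ht⟩ := aux_span (F := F) hc a b h (a * b)
  have e : (a - z • (1:R)) * (b - y • (1:R)) = (x + z * y) • (1:R) := by
    simp only [mul_sub, sub_mul, mul_smul_comm, smul_mul_assoc, mul_one, one_mul, ht]
    module
  have ne : (a - z • (1:R)) * (b - y • (1:R)) ≠ (b - y • (1:R)) * (a - z • (1:R)) := by
    intro h'
    apply h
    simp only [mul_sub, sub_mul, mul_smul_comm, smul_mul_assoc, mul_one, one_mul] at h'
    rw [← sub_eq_zero] at h' ⊢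
    rw [← h']
    module
  generalize a - z • (1:R) = a' at *
  generalize b - y • (1:R) = b' at *
  generalize x + z * y = c at *
  by_cases hc0 : c = 0
  · subst hc0
    rw [zero_smul] at e
    exact ⟨a', b', e, fun h' => ne (by rw [e, h'])⟩
  · exfalso
    have h1 : a' * (c⁻¹ • b') = 1 := by
      rw [mul_smul_comm, e, smul_smul, inv_mul_cancel₀ hc0, one_smul]
    have h2 : (c⁻¹ • b') * a' = 1 := mul_eq_one_symm h1
    apply ne
    rw [e, ← h2, smul_mul_assoc, smul_smul, mul_inv_cancel₀ hc0, one_smul]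

theorem aux_en {F R : Type*} [Field F] [Fintype F] [Ring R] [Fintype R] [Algebra F R]
    (hc : Fintype.card R = Fintype.card F ^ 3) (a b : R) (h : a * b ≠ b * a) :
    ∃ e n : R, e * e = e ∧ e * n = n ∧ n * e = 0 ∧ n * n = 0 ∧ n ≠ 0 := by
  obtain ⟨a, b, hab, hba⟩ := aux_zero (F := F) hc a b h
  have hne : a * b ≠ b * a := by rw [hab]; exact hba.symm
  have ha : a ≠ 0 := by rintro rfl; simp at hba
  have hb : b ≠ 0 := by rintro rfl; simp at hba
  obtain ⟨β, α, h1⟩ := aux_sq (F := F) hc a b hne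
  obtain ⟨δ, γ, h2⟩ := aux_sq (F := F) hc b a hne.symm
  have hβ : β = 0 := by
    have := congrArg (· * b) h1
    simp only [add_mul, smul_mul_assoc, one_mul, mul_assoc, hab, mul_zero, smul_zero,
      add_zero] at this
    exact (smul_eq_zero.mp this.symm).resolve_right hb
  have hδ : δ = 0 := by
    have := congrArg (a * ·) h2
    simp only [mul_add, mul_smul_comm, mul_one, ← mul_assoc, hab, zero_mul, smul_zero,
      add_zero] at this
    exact (smul_eq_zero.mp this.symm).resolve_right ha
  subst hβ hδ
  rw [zero_smul, zero_add] at h1 h2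
  by_cases hα : α = 0
  · by_cases hγ : γ = 0
    · exfalso
      subst hα hγ
      rw [zero_smul] at h1 h2
      obtain ⟨x, y, z, ht⟩ := aux_span (F := F) hc a b hne (b * a)
      have hx : x = 0 := by
        have := congrArg (a * ·) ht
        simp only [mul_add, mul_smul_comm, mul_one, ← mul_assoc, hab, h1, zero_mul, smul_zero,
          add_zero] at this
        exact (smul_eq_zero.mp this.symm).resolve_right ha
      subst hx
      have hy : y = 0 := by
        have := congrArg (b * ·) ht
        simp only [mul_add, mul_smul_comm, mul_one, ← mul_assoc, h2, zero_mul, smul_zero,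
          add_zero, zero_smul, zero_add] at this
        exact (smul_eq_zero.mp this.symm).resolve_right hba
      subst hy
      have hz : z = 0 := by
        have := congrArg (· * a) ht
        simp only [add_mul, smul_mul_assoc, one_mul, mul_assoc, h1, mul_zero, smul_zero,
          add_zero, zero_smul, zero_add] at this
        exact (smul_eq_zero.mp this.symm).resolve_right hba
      subst hz
      simp at ht
      exact hba ht
    · have he : (γ⁻¹ • b) * (γ⁻¹ • b) = γ⁻¹ • b := by
        rw [smul_mul_smul_comm, h2, smul_smul, mul_assoc, inv_mul_cancel₀ hγ, mul_one]
      have hae : a * (γ⁻¹ • b) = 0 := by rw [mul_smul_comm, hab, smul_zero]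
      have hea : (γ⁻¹ • b) * a ≠ 0 := by
        rw [smul_mul_assoc]; exact smul_ne_zero (inv_ne_zero hγ) hba
      generalize γ⁻¹ • b = e at *
      refine ⟨e, e * a, he, ?_, ?_, ?_, hea⟩
      · rw [← mul_assoc, he]
      · rw [mul_assoc, hae, mul_zero]
      · rw [mul_assoc, ← mul_assoc a, hae, zero_mul, mul_zero]
  · have he : (α⁻¹ • a) * (α⁻¹ • a) = α⁻¹ • a := by
      rw [smul_mul_smul_comm, h1, smul_smul, mul_assoc, inv_mul_cancel₀ hα, mul_one]
    have heb : (α⁻¹ • a) * b = 0 := by rw [smul_mul_assoc, hab, smul_zero]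
    have hbe : b * (α⁻¹ • a) ≠ 0 := by
      rw [mul_smul_comm]; exact smul_ne_zero (inv_ne_zero hα) hba
    generalize α⁻¹ • a = e at *
    have k1 : e * (b * e) = 0 := by rw [← mul_assoc, heb, zero_mul]
    have k2 : b * e * e = b * e := by rw [mul_assoc, he]
    refine ⟨1 - e, b * e, ?_, ?_, ?_, ?_, hbe⟩
    · simp [mul_sub, sub_mul, he]
    · rw [sub_mul, one_mul, k1, sub_zero]
    · rw [mul_sub, mul_one, k2, sub_self]
    · rw [mul_assoc, k1, mul_zero]

theorem aux_p {p : ℕ} (hp : p.Prime) (R : Type*) [Ring R] [Fintype R]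
    (hcard : Fintype.card R = p ^ 3) (a b : R) (h : a * b ≠ b * a) : (p : R) = 0 := by
  let C : AddSubgroup R := (Subring.centralizer {a}).toAddSubgroup
  let Z : AddSubgroup R := (Subring.center R).toAddSubgroup
  have hR : Nat.card R = p ^ 3 := by rw [Nat.card_eq_fintype_card, hcard]
  have hZC : Z < C := by
    refine lt_of_le_of_ne (fun x hx => ?_) (fun hh => ?_)
    · exact Subring.center_le_centralizer _ hx
    · have : a ∈ C := by
        change a ∈ Subring.centralizer {a}
        rw [Subring.mem_centralizer_iff]; simp
      rw [← hh] at this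
      exact h ((Subring.mem_center_iff.mp this b).symm)
  have hCT : C < ⊤ := by
    rw [lt_top_iff_ne_top]
    intro hh
    have : b ∈ C := by rw [hh]; trivial
    have : b ∈ Subring.centralizer {a} := this
    rw [Subring.mem_centralizer_iff] at this
    exact h (this a rfl)
  have l1 : Nat.card Z < Nat.card C := Set.Finite.card_lt_card (Set.toFinite _) hZC
  have l2 : Nat.card C < Nat.card R := by
    have : Nat.card C < Nat.card (⊤ : AddSubgroup R) :=
      Set.Finite.card_lt_card (Set.toFinite _) hCT
    simpa using this
  obtain ⟨i, hi, hi'⟩ := (Nat.dvd_prime_pow hp).mp (hR ▸ AddSubgroup.card_addSubgroup_dvd_card Z)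
  obtain ⟨j, hj, hj'⟩ := (Nat.dvd_prime_pow hp).mp (hR ▸ AddSubgroup.card_addSubgroup_dvd_card C)
  rw [hi', hj', Nat.pow_lt_pow_iff_right hp.one_lt] at l1
  rw [hR, hj', Nat.pow_lt_pow_iff_right hp.one_lt] at l2
  have hd : Nat.card Z ∣ p := by
    rw [hi']; conv_rhs => rw [← pow_one p]
    exact pow_dvd_pow p (by omega)
  have h1 : Nat.card Z • (⟨1, (Subring.center R).one_mem⟩ : Z) = 0 := card_nsmul_eq_zero'
  have h2 : (Nat.card Z : R) = 0 := by
    have h3 := congrArg (Subtype.val) h1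
    rw [AddSubgroup.coe_nsmul, nsmul_one] at h3
    exact h3
  obtain ⟨k, hk⟩ := hd
  rw [hk, Nat.cast_mul, h2, zero_mul]

def auxEquiv (p : ℕ) : upperTriangular2 p ≃ ZMod p × ZMod p × ZMod p where
  toFun M := (M.1 0 0, M.1 0 1, M.1 1 1)
  invFun t := ⟨!![t.1, t.2.1; 0, t.2.2], by change _ = _; simp⟩
  left_inv M := by
    have h : M.1 1 0 = 0 := M.2
    ext i j
    fin_cases i <;> fin_cases j <;> simp [h]
  right_inv t := by simp

def auxHom (p : ℕ) [Fact p.Prime] (R : Type*) [Ring R] [Algebra (ZMod p) R] (e n : R)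
    (he : e * e = e) (hen : e * n = n) (hne : n * e = 0) (hnn : n * n = 0) :
    upperTriangular2 p →+* R where
  toFun M := M.1 0 0 • e + M.1 0 1 • n + M.1 1 1 • (1 - e)
  map_one' := by simp
  map_zero' := by simp
  map_add' M N := by simp; module
  map_mul' M N := by
    have h : M.1 1 0 = 0 := M.2
    have h' : N.1 1 0 = 0 := N.2
    simp [Matrix.mul_apply, Fin.sum_univ_two, h, h', mul_add, add_mul, mul_sub, sub_mul, he, hen,
      hne, hnn]
    module

/-- Every noncommutative ring of order p³ (p prime) is isomorphic to the ring
of 2×2 upper triangular matrices over the field with p elements. -/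
theorem noncommutative_ring_of_order_p_cubed (p : ℕ) (hp : p.Prime)
    (R : Type*) [Ring R] [Fintype R] (hcard : Fintype.card R = p ^ 3)
    (hnc : ¬ ∀ a b : R, a * b = b * a) :
    Nonempty (R ≃+* upperTriangular2 p) := by
  push Not at hnc
  obtain ⟨a, b, hab⟩ := hnc
  haveI : Fact p.Prime := ⟨hp⟩
  have hp0 := aux_p hp R hcard a b hab
  haveI : Nontrivial R := ⟨⟨_, _, hab⟩⟩
  haveI : CharP R p := (CharP.charP_iff_prime_eq_zero hp).mpr hp0
  letI : Algebra (ZMod p) R := ZMod.algebra R p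
  obtain ⟨e, n, he, hen, hne, hnn, hn⟩ :=
    aux_en (F := ZMod p) (by rw [hcard, ZMod.card]) a b hab
  let f := auxHom p R e n he hen hne hnn
  have hf : Function.Injective f := by
    rw [injective_iff_map_eq_zero]
    intro M hM
    have hM' : M.1 0 0 • e + M.1 0 1 • n + M.1 1 1 • (1 - e) = 0 := hM
    have h10 : M.1 1 0 = 0 := M.2
    have he0 : e ≠ 0 := by rintro rfl; simp at hen; exact hn hen.symm
    have h00 : M.1 0 0 = 0 := by
      have := congrArg (fun t => e * t * e) hM'
      simp [mul_add, add_mul, mul_sub, he, hen, hne, he0] at this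
      exact this
    have h01 : M.1 0 1 = 0 := by
      have := congrArg (fun t => e * t) hM'
      simp [mul_add, mul_sub, he, hen, h00, hn] at this
      exact this
    have h11 : M.1 1 1 = 0 := by
      have := congrArg (fun t => n * t) hM'
      simp [mul_add, mul_sub, hne, h00, h01, hn] at this
      exact this
    ext i j
    fin_cases i <;> fin_cases j <;> simp [h00, h01, h10, h11]
  have hbij : Function.Bijective f := by
    rw [Nat.bijective_iff_injective_and_card]
    refine ⟨hf, ?_⟩
    rw [Nat.card_congr (auxEquiv p), Nat.card_eq_fintype_card, Nat.card_eq_fintype_card, hcard]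
    simp [ZMod.card]; ring
  exact ⟨(RingEquiv.ofBijective f hbij).symm⟩
end

section
/- Every finite abelian ring is NI: if R is a finite ring (associative, with identity) in which every idempotent is central, then the set N(R) of nilpotent elements of R forms a two-sided ideal of R. -/
theorem aux_idem_pow {R : Type*} [Ring R] [Fintype R] (x : R) :
    ∃ n : ℕ, x ^ (n + 1) * x ^ (n + 1) = x ^ (n + 1) := by
  obtain ⟨i, j, hij, h⟩ : ∃ i j : ℕ, i < j ∧ x ^ i = x ^ j := by
    obtain ⟨i, j, hne, h⟩ := Finite.exists_ne_map_eq_of_infinite (fun n : ℕ => x ^ n)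
    rcases lt_or_gt_of_ne hne with hl | hl
    · exact ⟨i, j, hl, h⟩
    · exact ⟨j, i, hl, h.symm⟩
  obtain ⟨p, rfl⟩ := Nat.exists_eq_add_of_lt hij
  have key : ∀ k m : ℕ, x ^ (i + m + k * (p + 1)) = x ^ (i + m) := by
    intro k
    induction k with
    | zero => intro m; simp
    | succ k ih =>
      intro m
      have e1 : i + m + (k + 1) * (p + 1) = (i + p + 1) + (m + k * (p + 1)) := by ring
      rw [e1, pow_add, ← h, ← pow_add, ← add_assoc, ih]
  refine ⟨i + i * p + p, ?_⟩
  have h1 := key (i + 1) (i * p + p + 1)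
  rw [← pow_add]
  convert h1 using 2 <;> ring

theorem aux_idem_nil {R : Type*} [Ring R] (e : R) (he : e * e = e) (hn : IsNilpotent e) :
    e = 0 := by
  obtain ⟨k, hk⟩ := hn
  have h : e ^ (k + 1) = e := IsIdempotentElem.pow_succ_eq k he
  rw [← h, pow_succ, hk, zero_mul]

theorem aux_mul_left {R : Type*} [Ring R] [Fintype R]
    (habelian : ∀ e : R, e * e = e → ∀ x : R, e * x = x * e)
    (r a : R) (ha : IsNilpotent a) : IsNilpotent (r * a) := by
  obtain ⟨n, hn⟩ := aux_idem_pow (r * a)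
  have hc := habelian _ hn
  have hs : (r * a) ^ (n + 1) = ((r * a) ^ n * r) * a := by rw [pow_succ, mul_assoc]
  refine ⟨n + 1, ?_⟩
  generalize (r * a) ^ (n + 1) = e at *
  generalize (r * a) ^ n * r = s at *
  have key : ∀ k : ℕ, e = s ^ (k + 1) * a ^ (k + 1) := by
    intro k
    induction k with
    | zero => simpa using hs
    | succ k ih =>
      calc e = e * e := hn.symm
        _ = e * (s * a) := by rw [← hs]
        _ = s * e * a := by rw [← mul_assoc, hc s]
        _ = s * (s ^ (k + 1) * a ^ (k + 1)) * a := by rw [← ih]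
        _ = _ := by rw [pow_succ' s (k + 1), pow_succ a (k + 1)]; simp only [mul_assoc]
  obtain ⟨k, hk⟩ := ha
  rw [key k, pow_succ a, hk, zero_mul, mul_zero]

theorem aux_mul_right {R : Type*} [Ring R] [Fintype R]
    (habelian : ∀ e : R, e * e = e → ∀ x : R, e * x = x * e)
    (r a : R) (ha : IsNilpotent a) : IsNilpotent (a * r) := by
  obtain ⟨n, hn⟩ := aux_mul_left habelian r a ha
  have key : ∀ n : ℕ, (a * r) ^ (n + 1) = a * (r * a) ^ n * r := by
    intro n
    induction n with
    | zero => simp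
    | succ n ih => rw [pow_succ, ih, pow_succ (r * a)]; simp only [mul_assoc]
  exact ⟨n + 1, by rw [key, hn, mul_zero, zero_mul]⟩

/-- Every finite abelian ring (all idempotents central) is NI: the nilpotent
elements form a two-sided ideal, i.e. they are closed under addition and under
left and right multiplication by arbitrary elements. -/
theorem finite_abelian_ring_is_NI (R : Type*) [Ring R] [Fintype R]
    (habelian : ∀ e : R, e * e = e → ∀ x : R, e * x = x * e) :
    (∀ a b : R, IsNilpotent a → IsNilpotent b → IsNilpotent (a + b)) ∧
      (∀ r a : R, IsNilpotent a → IsNilpotent (r * a) ∧ IsNilpotent (a * r)) := by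
  refine ⟨?_, fun r a ha => ⟨aux_mul_left habelian r a ha, aux_mul_right habelian r a ha⟩⟩
  intro a b ha hb
  obtain ⟨n, hn⟩ := aux_idem_pow (a + b)
  refine ⟨n + 1, aux_idem_nil _ hn ?_⟩
  have hc := habelian _ hn
  have hu := aux_mul_right habelian ((a + b) ^ n) a ha
  have hv := aux_mul_right habelian ((a + b) ^ n) b hb
  have hs : (a + b) ^ (n + 1) = a * (a + b) ^ n + b * (a + b) ^ n := by
    rw [pow_succ', add_mul]
  generalize (a + b) ^ (n + 1) = e at *
  generalize a * (a + b) ^ n = u at *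
  generalize b * (a + b) ^ n = v at *
  have hcomm : Commute u v := by
    have h := hc u
    rw [hs, add_mul, mul_add] at h
    exact (add_left_cancel h).symm
  rw [hs]
  exact hcomm.isNilpotent_add hu hv
end

section
/- Every ring (associative, with identity) with fewer than 16 elements is NI: if R is a finite ring with card(R) < 16, then the set N(R) of nilpotent elements of R forms a two-sided ideal of R. -/
theorem matrix_aux {D : Type*} [DivisionRing D] {d : ℕ} (hd : d = 1) (k : ℕ)
    (M : Matrix (Fin d) (Fin d) D) (h : M ^ k = 0) : M = 0 := by
  subst hd
  have hp : ∀ k : ℕ, (M ^ k) 0 0 = (M 0 0) ^ k := by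
    intro k
    induction k with
    | zero => simp
    | succ k ih => simp [pow_succ, Matrix.mul_apply, ih]
  have h0 : (M 0 0) ^ k = 0 := by rw [← hp, h]; rfl
  ext i j
  rw [Subsingleton.elim i 0, Subsingleton.elim j 0]
  exact eq_zero_of_pow_eq_zero h0

theorem semisimple_aux (S : Type*) [Ring S] [Finite S] [IsSemisimpleRing S]
    (h : Nat.card S < 16) (x : S) (hx : IsNilpotent x) : x = 0 := by
  obtain ⟨n, D, d, iD, hd, ⟨e⟩⟩ := IsSemisimpleRing.exists_ringEquiv_pi_matrix_divisionRing S
  have hfin : Finite (∀ i, Matrix (Fin (d i)) (Fin (d i)) (D i)) := Finite.of_equiv _ e.toEquiv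
  have key : ∀ i, d i = 1 := by
    intro i
    have := (hd i).out
    by_contra hne
    have h2 : 2 ≤ d i := by omega
    have hs : Function.Surjective
        (fun f : (∀ i, Matrix (Fin (d i)) (Fin (d i)) (D i)) => f i) :=
      Function.surjective_eval i
    have hf := Finite.of_surjective _ hs
    have hc := Nat.card_le_card_of_surjective _ hs
    rw [← Nat.card_congr e.toEquiv] at hc
    have hpos : Nonempty (Fin (d i)) := ⟨⟨0, by omega⟩⟩
    have hDf : Finite (D i) := Finite.of_injective
      (fun a : D i => Matrix.of (fun (_ _ : Fin (d i)) => a))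
      (fun a b hab => congrFun (congrFun hab ⟨0, by omega⟩) ⟨0, by omega⟩)
    have hD : 2 ≤ Nat.card (D i) := Finite.one_lt_card
    have hm : Nat.card (Matrix (Fin (d i)) (Fin (d i)) (D i))
        = (Nat.card (D i) ^ d i) ^ d i := by
      unfold Matrix
      rw [Nat.card_fun, Nat.card_fun, Nat.card_fin]
    have h16 : 16 ≤ (Nat.card (D i) ^ d i) ^ d i := by
      rw [← pow_mul]
      calc 16 = 2 ^ (2 * 2) := by norm_num
        _ ≤ 2 ^ (d i * d i) := Nat.pow_le_pow_right (by norm_num) (Nat.mul_le_mul h2 h2)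
        _ ≤ _ := Nat.pow_le_pow_left hD _
    omega
  have hex : IsNilpotent (e x) := hx.map e
  obtain ⟨k, hk⟩ := hex
  have hz : e x = 0 := by
    funext i
    have hki : (e x i) ^ k = 0 := congrFun hk i
    exact matrix_aux (key i) k _ hki
  simpa using hz

/-- Every ring with fewer than 16 elements is NI: its nilpotent elements form a
two-sided ideal, i.e. they are closed under addition and under left and right
multiplication by arbitrary elements. -/
theorem ring_of_order_lt_16_is_NI (R : Type*) [Ring R] [Fintype R]
    (hcard : Fintype.card R < 16) :
    (∀ a b : R, IsNilpotent a → IsNilpotent b → IsNilpotent (a + b)) ∧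
      (∀ r a : R, IsNilpotent a → IsNilpotent (r * a) ∧ IsNilpotent (a * r)) := by
  have hiff : ∀ a : R, IsNilpotent a ↔ a ∈ Ring.jacobson R := by
    intro a
    constructor
    · intro ha
      rw [← Ideal.Quotient.eq_zero_iff_mem]
      refine semisimple_aux (R ⧸ Ring.jacobson R) ?_ _ (ha.map (Ideal.Quotient.mk _))
      have := Nat.card_le_card_of_surjective _ (Ideal.Quotient.mk_surjective (I := Ring.jacobson R))
      rw [← Nat.card_eq_fintype_card] at hcard
      exact lt_of_le_of_lt this hcard
    · intro ha
      obtain ⟨n, hn⟩ := IsSemiprimaryRing.isNilpotent (R := R)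
      refine ⟨n, ?_⟩
      have := Ideal.pow_mem_pow ha n
      rw [hn] at this
      simpa using this
  simp only [hiff]
  exact ⟨fun a b => Ideal.add_mem _, fun r a ha =>
    ⟨Ideal.mul_mem_left _ _ ha, Ideal.mul_mem_right _ _ ha⟩⟩
end

section
/- The ring M₂(F₂) of 2×2 matrices over the field with two elements is reflexive but not NI. That is: (i) for all a, b ∈ M₂(ZMod 2), if a·r·b = 0 for every r ∈ M₂(ZMod 2), then b·r·a = 0 for every r ∈ M₂(ZMod 2); and (ii) the set of nilpotent elements of M₂(ZMod 2) is not closed under addition (there exist nilpotent matrices a, b over ZMod 2 with a + b not nilpotent), so the nilpotent elements do not form a two-sided ideal. -/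
/-- M₂(F₂) is reflexive but not NI: (i) for all a, b, if aRb = 0 then bRa = 0;
(ii) there are nilpotent matrices whose sum is not nilpotent, so the nilpotent
elements do not form a two-sided ideal. -/
theorem matrix_ring_F2_reflexive_not_NI :
    (∀ a b : Matrix (Fin 2) (Fin 2) (ZMod 2),
        (∀ r : Matrix (Fin 2) (Fin 2) (ZMod 2), a * r * b = 0) →
        ∀ r : Matrix (Fin 2) (Fin 2) (ZMod 2), b * r * a = 0) ∧
    (∃ a b : Matrix (Fin 2) (Fin 2) (ZMod 2),
        IsNilpotent a ∧ IsNilpotent b ∧ ¬ IsNilpotent (a + b)) := by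
  constructor
  · intro a b h r
    have key : ∀ i j k l, a i j * b k l = 0 := by
      intro i j k l
      have h1 := congrFun (congrFun (h (Matrix.single j k 1)) i) l
      revert h1
      fin_cases i <;> fin_cases j <;> fin_cases k <;> fin_cases l <;>
        simp [Matrix.mul_apply, Fin.sum_univ_two, Matrix.single_apply]
    by_cases ha : a = 0
    · simp [ha]
    · have hb : b = 0 := by
        by_contra hb
        apply ha
        ext i j
        by_contra hij
        apply hb
        ext k l
        exact (mul_eq_zero.mp (key i j k l)).resolve_left hij
      simp [hb]
  · refine ⟨!![0, 1; 0, 0], !![0, 0; 1, 0], ⟨2, by decide⟩, ⟨2, by decide⟩, ?_⟩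
    intro h
    have hc : (!![0, 1; 0, 0] + !![0, 0; 1, 0] : Matrix (Fin 2) (Fin 2) (ZMod 2)) *
        (!![0, 1; 0, 0] + !![0, 0; 1, 0]) = 1 := by decide
    exact h.not_isUnit (IsUnit.of_mul_eq_one _ hc)
end

section
/- Let p be a prime number. Every ring (associative, with identity) with exactly p⁴ elements that is not NI is isomorphic to the full matrix ring M₂(F_p) of 2×2 matrices over the field with p elements. -/
theorem matrix_one_nilp {D : Type*} [DivisionRing D] {d : ℕ} (h : d = 1)
    (M : Matrix (Fin d) (Fin d) D) (hM : IsNilpotent M) : M = 0 := by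
  subst h
  obtain ⟨m, hm⟩ := hM
  have key : ∀ k, (M ^ k) 0 0 = (M 0 0) ^ k := by
    intro k
    induction k with
    | zero => simp
    | succ k ih => rw [pow_succ, pow_succ, Matrix.mul_apply, ← ih]; simp
  have h0 : (M 0 0) ^ m = 0 := by rw [← key, hm]; rfl
  have h1 : M 0 0 = 0 := eq_zero_of_pow_eq_zero h0
  ext i j
  rw [Subsingleton.elim i 0, Subsingleton.elim j 0, h1]
  rfl

/-- Every non-NI ring of order p⁴ (p prime) is isomorphic to the full 2×2 matrix
ring over the field with p elements. A ring is NI when its nilpotent elements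
form a two-sided ideal, i.e. are closed under addition and under left and right
multiplication by arbitrary elements. -/
theorem non_NI_ring_of_order_p_fourth (p : ℕ) (hp : p.Prime)
    (R : Type*) [Ring R] [Fintype R] (hcard : Fintype.card R = p ^ 4)
    (hnotNI : ¬ ((∀ a b : R, IsNilpotent a → IsNilpotent b → IsNilpotent (a + b)) ∧
        (∀ r a : R, IsNilpotent a → IsNilpotent (r * a) ∧ IsNilpotent (a * r)))) :
    Nonempty (R ≃+* Matrix (Fin 2) (Fin 2) (ZMod p)) := by
  have : Fact p.Prime := ⟨hp⟩
  obtain ⟨n, D, d, hD, hd, ⟨e⟩⟩ := IsSemisimpleRing.exists_ringEquiv_pi_matrix_divisionRing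
    (R ⧸ Ring.jacobson R)
  let q : R →+* R ⧸ Ring.jacobson R := Ideal.Quotient.mk _
  let f := e.toRingHom.comp q
  have hq : Function.Surjective q := Ideal.Quotient.mk_surjective
  have hf : Function.Surjective f := e.surjective.comp hq
  by_cases h : ∀ i, d i < 2
  · exfalso
    have key : ∀ a : R, IsNilpotent a ↔ f a = 0 := by
      intro a
      constructor
      · intro ha
        funext i
        have h1 : d i = 1 := by
          have := h i
          have := (hd i).out
          omega
        have hn : IsNilpotent (f a i) := (ha.map f).map (Pi.evalRingHom _ i)
        exact matrix_one_nilp h1 _ hn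
      · intro ha
        have h0 : q a = 0 := (map_eq_zero_iff e e.injective).mp ha
        have hJ : a ∈ Ring.jacobson R := Ideal.Quotient.eq_zero_iff_mem.mp h0
        obtain ⟨m, hm⟩ := IsSemiprimaryRing.isNilpotent (R := R)
        refine ⟨m, ?_⟩
        have := Ideal.pow_mem_pow hJ m
        rw [hm] at this
        simpa using this
    apply hnotNI
    simp only [key, map_add, map_mul]
    refine ⟨?_, ?_⟩
    · intro a b ha hb; rw [ha, hb, add_zero]
    · intro r a ha; rw [ha, mul_zero, zero_mul]; exact ⟨rfl, rfl⟩
  · push Not at h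
    obtain ⟨i, hi⟩ := h
    let g : R →+* Matrix (Fin (d i)) (Fin (d i)) (D i) := (Pi.evalRingHom _ i).comp f
    have hg : Function.Surjective g := (Function.surjective_eval i).comp hf
    have hdvd : Nat.card (Matrix (Fin (d i)) (Fin (d i)) (D i)) ∣ Nat.card R :=
      AddSubgroup.card_dvd_of_surjective g.toAddMonoidHom hg
    have : Finite (Matrix (Fin (d i)) (Fin (d i)) (D i)) := Finite.of_surjective g hg
    have hc : Nat.card (Matrix (Fin (d i)) (Fin (d i)) (D i)) = Nat.card (D i) ^ (d i * d i) := by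
      unfold Matrix
      simp [Nat.card_fun, pow_mul]
    have hR : Nat.card R = p ^ 4 := by rw [Nat.card_eq_fintype_card, hcard]
    have hpos : d i * d i ≠ 0 := by positivity
    rw [hc, hR] at hdvd
    obtain ⟨k, hk, hDk⟩ := (Nat.dvd_prime_pow hp).mp ((dvd_pow_self _ hpos).trans hdvd)
    have : Finite (D i) := Nat.finite_of_card_ne_zero (by rw [hDk]; exact (pow_pos hp.pos k).ne')
    have hk0 : k ≠ 0 := by
      rintro rfl
      have := Finite.one_lt_card (α := D i)
      simp [hDk] at this
    have hle : k * (d i * d i) ≤ 4 := by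
      rw [hDk, ← pow_mul] at hdvd
      exact (Nat.pow_dvd_pow_iff_le_right hp.one_lt).mp hdvd
    have hd2 : d i = 2 := by
      have : 1 ≤ k := by omega
      nlinarith
    have hk1 : k = 1 := by rw [hd2] at hle; omega
    rw [hk1, pow_one] at hDk
    have hbij : Function.Bijective g := by
      refine (Nat.bijective_iff_surjective_and_card g).mpr ⟨hg, ?_⟩
      rw [hc, hR, hDk, hd2]
    have := Fintype.ofFinite (D i)
    let z : ZMod p ≃+* D i := ZMod.ringEquivOfPrime (D i) hp (by rw [← Nat.card_eq_fintype_card, hDk])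
    exact ⟨(RingEquiv.ofBijective g hbij).trans
      ((z.symm.mapMatrix).trans (Matrix.reindexRingEquiv _ (finCongr hd2)))⟩
end

section
/- Every finite local ring (associative, with identity) with fewer than 64 elements is semicommutative: if R is a finite local ring with card(R) < 64, then for all a, b ∈ R, ab = 0 implies arb = 0 for every r ∈ R. -/
namespace SemiComm

/-- The additive group of nonunits. -/
def J (R : Type*) [Ring R] [Finite R] [IsLocalRing R] : Submodule ℤ R :=
  AddSubgroup.toIntSubmodule
  { carrier := {x | ¬ IsUnit x}
    zero_mem' := by simp
    add_mem' := by
      intro a b ha hb h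
      obtain ⟨u, hu⟩ := h
      have h1 : (↑u⁻¹ * a : R) + ↑u⁻¹ * b = 1 := by
        rw [← mul_add, ← hu]; simp
      rcases IsLocalRing.isUnit_or_isUnit_of_add_one h1 with h | h
      · exact ha (by simpa using h)
      · exact hb (by simpa using h)
    neg_mem' := by intro x hx; simpa using hx }

section
variable {R : Type*} [Ring R] [Finite R] [IsLocalRing R]

theorem mem_J {x : R} : x ∈ J R ↔ ¬ IsUnit x := Iff.rfl

theorem mul_left_J {x : R} (r : R) (hx : x ∈ J R) : r * x ∈ J R := by
  rw [mem_J] at *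
  rintro ⟨u, hu⟩
  apply hx
  have h1 : (↑u⁻¹ * r) * x = 1 := by rw [mul_assoc, ← hu]; simp
  exact ⟨⟨x, ↑u⁻¹ * r, mul_eq_one_symm h1, h1⟩, rfl⟩

theorem mul_right_J {x : R} (r : R) (hx : x ∈ J R) : x * r ∈ J R := by
  rw [mem_J] at *
  rintro ⟨u, hu⟩
  apply hx
  have h1 : x * (r * ↑u⁻¹) = 1 := by rw [← mul_assoc, ← hu]; simp
  exact ⟨⟨x, r * ↑u⁻¹, h1, mul_eq_one_symm h1⟩, rfl⟩

/-- residue field size -/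
noncomputable def q (R : Type*) [Ring R] [Finite R] [IsLocalRing R] : ℕ :=
  (J R).toAddSubgroup.index

theorem card_map (y : R) (hy : y ≠ 0) :
    Nat.card ((⊤ : AddSubgroup R).map (AddMonoidHom.mulRight y)) =
      q R * Nat.card ((J R).toAddSubgroup.map (AddMonoidHom.mulRight y)) := by
  have hk : (AddMonoidHom.mulRight y).ker ≤ (J R).toAddSubgroup := by
    intro r hr
    rw [AddMonoidHom.mem_ker] at hr
    show ¬ IsUnit r
    rintro ⟨u, rfl⟩
    apply hy
    simpa using hr
  have h := AddSubgroup.relIndex_map_map (AddMonoidHom.mulRight y) (J R).toAddSubgroup ⊤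
  rw [sup_eq_left.2 hk, top_sup_eq, AddSubgroup.relIndex_top_right] at h
  have h2 := AddSubgroup.relIndex_mul_relIndex (⊥ : AddSubgroup R)
    ((J R).toAddSubgroup.map (AddMonoidHom.mulRight y))
    ((⊤ : AddSubgroup R).map (AddMonoidHom.mulRight y)) bot_le (AddSubgroup.map_mono le_top)
  rw [AddSubgroup.relIndex_bot_left, AddSubgroup.relIndex_bot_left, h] at h2
  rw [← h2, mul_comm, q]

theorem chain (k : ℕ) : ∀ y : R, (∃ x ∈ (J R)^k, x * y ≠ 0) →
    q R ^ (k+1) ≤ Nat.card ((⊤ : AddSubgroup R).map (AddMonoidHom.mulRight y)) := by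
  induction k with
  | zero =>
    rintro y ⟨x, -, hx⟩
    rw [card_map y (right_ne_zero_of_mul hx)]
    rw [zero_add, pow_one]
    exact Nat.le_mul_of_pos_right _ Nat.card_pos
  | succ k ih =>
    rintro y ⟨x, hx, hxy⟩
    rw [card_map y (right_ne_zero_of_mul hxy), pow_succ']
    apply Nat.mul_le_mul_left
    have : ∃ w ∈ (J R)^k, ∃ z ∈ J R, w * z * y ≠ 0 := by
      by_contra! hc
      apply hxy
      rw [pow_succ] at hx
      induction hx using Submodule.mul_induction_on' with
      | mem_mul_mem m hm n hn => exact hc m hm n hn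
      | add a _ b _ ha hb =>
        by_cases h1 : a * y = 0
        · by_cases h2 : b * y = 0
          · rw [add_mul, h1, h2, add_zero]
          · exact absurd (hb h2) h2
        · exact absurd (ha h1) h1
    obtain ⟨w, hw, z, hz, hne⟩ := this
    refine (ih (z * y) ⟨w, hw, by rwa [← mul_assoc]⟩).trans ?_
    apply AddSubgroup.card_le_of_le
    rintro _ ⟨r, -, rfl⟩
    exact ⟨r * z, mul_left_J r hz, by simp [mul_assoc]⟩

theorem chain' (k : ℕ) (h : (J R)^k ≠ ⊥) : q R ^ (k+1) ≤ Nat.card R := by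
  obtain ⟨x, hx, hne⟩ := (Submodule.ne_bot_iff _).1 h
  exact (chain k 1 ⟨x, hx, by simpa using hne⟩).trans (AddSubgroup.card_le_card_addGroup _)

theorem one_not_mem_J : (1 : R) ∉ J R := by simp [mem_J]

theorem two_le_q : 2 ≤ q R := by
  have h1 : q R ≠ 1 := by
    intro h
    rw [q, AddSubgroup.index_eq_one] at h
    exact one_not_mem_J (R := R) (show (1:R) ∈ (J R).toAddSubgroup by rw [h]; trivial)
  have h0 : q R ≠ 0 := AddSubgroup.index_ne_zero_of_finite
  omega

theorem cyc (H K : AddSubgroup R) (h3 : H.relIndex K ≤ 3) (m : R) (hm : m ∈ K) (hm' : m ∉ H)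
    (x : R) (hx : x ∈ K) : ∃ n : ℤ, x - n • m ∈ H := by
  have h1 : H.relIndex K ≠ 1 := by
    intro h
    exact hm' (AddSubgroup.relIndex_eq_one.1 h hm)
  have h0 : H.relIndex K ≠ 0 := AddSubgroup.index_ne_zero_of_finite
  have hp : (H.relIndex K).Prime := by
    interval_cases h : H.relIndex K <;> simp_all <;> norm_num
  have : Fact (H.relIndex K).Prime := ⟨hp⟩
  have hc : Nat.card (K ⧸ H.addSubgroupOf K) = H.relIndex K := rfl
  have hne : ((⟨m, hm⟩ : K) : K ⧸ H.addSubgroupOf K) ≠ 0 := by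
    rw [Ne, QuotientAddGroup.eq_zero_iff]
    simpa [AddSubgroup.mem_addSubgroupOf] using hm'
  obtain ⟨n, hn⟩ := mem_zmultiples_of_prime_card hc hne
    (g' := ((⟨x, hx⟩ : K) : K ⧸ H.addSubgroupOf K))
  refine ⟨n, ?_⟩
  have h2 : (((⟨x, hx⟩ : K) - n • (⟨m, hm⟩ : K) : K) : K ⧸ H.addSubgroupOf K) = 0 := by
    rw [QuotientAddGroup.mk_sub, QuotientAddGroup.mk_zsmul, sub_eq_zero]
    exact hn.symm
  rw [QuotientAddGroup.eq_zero_iff] at h2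
  simpa [AddSubgroup.mem_addSubgroupOf] using h2

theorem red (hq : q R ≤ 3) (r : R) : ∃ n : ℤ, r - (n : R) ∈ J R := by
  obtain ⟨n, hn⟩ := cyc (J R).toAddSubgroup ⊤ (by rw [AddSubgroup.relIndex_top_right]; exact hq) 1
    trivial one_not_mem_J r trivial
  exact ⟨n, by simpa using hn⟩

theorem pow_anti (k : ℕ) (hk : 1 ≤ k) : (J R)^(k+1) ≤ (J R)^k := by
  obtain ⟨j, rfl⟩ : ∃ j, k = j + 1 := ⟨k-1, by omega⟩
  rw [pow_succ (J R) (j+1), pow_succ (J R) j, mul_assoc]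
  refine mul_le_mul' le_rfl ?_
  rw [Submodule.mul_le]
  intro a _ b hb
  exact mul_left_J a hb

theorem comm_of_cyc (x : R) (hx : x ∈ J R) (hq : q R ≤ 3) (h5 : (J R)^5 = ⊥)
    (h : ∀ y ∈ J R, ∃ n : ℤ, y - n • x ∈ (J R)^2) (a b : R) : a * b = b * a := by
  let S : Subalgebra ℤ R := Algebra.adjoin ℤ {x}
  have hxS : x ∈ S := Algebra.subset_adjoin rfl
  have key : ∀ k : ℕ, 1 ≤ k → ∀ y ∈ (J R)^k, ∃ n : ℤ, y - n • x^k ∈ (J R)^(k+1) := by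
    intro k hk
    induction k, hk using Nat.le_induction with
    | base => simpa using h
    | succ k hk ih =>
      intro y hy
      rw [pow_succ] at hy
      induction hy using Submodule.mul_induction_on' with
      | mem_mul_mem u hu v hv =>
        obtain ⟨n, hn⟩ := ih u hu
        obtain ⟨m, hm⟩ := h v hv
        refine ⟨n * m, ?_⟩
        have e : u * v - (n * m) • x^(k+1) = (u - n • x^k) * v + (n • x^k) * (v - m • x) := by
          rw [sub_mul, mul_sub, smul_mul_smul_comm, pow_succ]; abel
        rw [e]
        apply Submodule.add_mem
        · rw [pow_succ]; exact Submodule.mul_mem_mul hn hv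
        · rw [show k + 1 + 1 = k + 2 from rfl, pow_add]
          exact Submodule.mul_mem_mul (Submodule.smul_mem _ _ (Submodule.pow_mem_pow _ hx k)) hm
      | add u _ v _ hu hv =>
        obtain ⟨n, hn⟩ := hu
        obtain ⟨m, hm⟩ := hv
        refine ⟨n + m, ?_⟩
        have e : u + v - (n+m) • x^(k+1) = (u - n • x^(k+1)) + (v - m • x^(k+1)) := by
          rw [add_smul]; abel
        rw [e]; exact Submodule.add_mem _ hn hm
  have step : ∀ k : ℕ, 1 ≤ k → (∀ y ∈ (J R)^(k+1), y ∈ S) → ∀ y ∈ (J R)^k, y ∈ S := by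
    intro k hk hS y hy
    obtain ⟨n, hn⟩ := key k hk y hy
    have := S.add_mem (hS _ hn) (S.zsmul_mem (S.pow_mem hxS k) n)
    simpa using this
  have s5 : ∀ y ∈ (J R)^5, y ∈ S := by
    intro y hy
    rw [h5, Submodule.mem_bot] at hy
    rw [hy]; exact S.zero_mem
  have s1 := step 1 (by norm_num) <| step 2 (by norm_num) <| step 3 (by norm_num) <|
    step 4 (by norm_num) s5
  have all : ∀ r : R, r ∈ S := by
    intro r
    obtain ⟨n, hn⟩ := red hq r
    have := S.add_mem (s1 _ (by simpa using hn)) (S.intCast_mem n)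
    simpa using this
  have hcx : ∀ r : R, r * x = x * r := by
    intro r
    have := all r
    induction this using Algebra.adjoin_induction with
    | mem y hy => rw [Set.mem_singleton_iff.1 hy]
    | algebraMap n => exact Algebra.commutes n x
    | add u v _ _ hu hv => rw [add_mul, mul_add, hu, hv]
    | mul u v _ _ hu hv => rw [mul_assoc, hv, ← mul_assoc, hu, mul_assoc]
  have := all b
  induction this using Algebra.adjoin_induction with
  | mem y hy => rw [Set.mem_singleton_iff.1 hy]; exact hcx a
  | algebraMap n => exact (Algebra.commutes n a).symm
  | add u v _ _ hu hv => rw [add_mul, mul_add, hu, hv]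
  | mul u v _ _ hu hv => rw [← mul_assoc, hu, mul_assoc, hv, mul_assoc]

theorem card_step (k : ℕ) (hk : 1 ≤ k) :
    Nat.card ↥((J R)^(k+1)).toAddSubgroup *
      ((J R)^(k+1)).toAddSubgroup.relIndex ((J R)^k).toAddSubgroup
      = Nat.card ↥((J R)^k).toAddSubgroup := by
  have h2 := AddSubgroup.relIndex_mul_relIndex (⊥ : AddSubgroup R)
    ((J R)^(k+1)).toAddSubgroup ((J R)^k).toAddSubgroup bot_le (pow_anti k hk)
  simpa [AddSubgroup.relIndex_bot_left] using h2

theorem strict (k : ℕ) (hk : 1 ≤ k) (h5 : (J R)^5 = ⊥) (hne : (J R)^k ≠ ⊥) :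
    ¬ (J R)^k ≤ (J R)^(k+1) := by
  intro h
  have e : (J R)^k = (J R)^(k+1) := le_antisymm h (pow_anti k hk)
  have : ∀ j, (J R)^k = (J R)^(k+j) := by
    intro j
    induction j with
    | zero => rfl
    | succ j ih => rw [← add_assoc, pow_succ, ← ih, ← pow_succ, ← e]
  apply hne
  rw [this 5, pow_add, h5, Submodule.mul_bot]

theorem idx_ge (k : ℕ) (hk : 1 ≤ k) (h5 : (J R)^5 = ⊥) (hne : (J R)^k ≠ ⊥) :
    2 ≤ ((J R)^(k+1)).toAddSubgroup.relIndex ((J R)^k).toAddSubgroup := by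
  have h0 : ((J R)^(k+1)).toAddSubgroup.relIndex ((J R)^k).toAddSubgroup ≠ 0 :=
    AddSubgroup.index_ne_zero_of_finite
  have h1 : ((J R)^(k+1)).toAddSubgroup.relIndex ((J R)^k).toAddSubgroup ≠ 1 := by
    intro h
    exact strict k hk h5 hne (AddSubgroup.relIndex_eq_one.1 h)
  omega

theorem main (hcard : Nat.card R < 64) (a b : R) (hab : a * b = 0) (r : R) : a * r * b = 0 := by
  have hq2 := two_le_q (R := R)
  have h5 : (J R)^5 = ⊥ := by
    by_contra h
    have : q R ^ 6 ≤ _ := chain' 5 h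
    have := Nat.pow_le_pow_left hq2 6
    omega
  by_cases ha : a ∈ J R
  swap
  · rw [mem_J, not_not] at ha
    rw [ha.mul_right_eq_zero.1 hab, mul_zero]
  by_cases hb : b ∈ J R
  swap
  · rw [mem_J, not_not] at hb
    rw [hb.mul_left_eq_zero.1 hab, zero_mul, zero_mul]
  by_cases h2 : (J R)^2 = ⊥
  · have : a * r * b ∈ (J R)^2 := by
      rw [pow_two]; exact Submodule.mul_mem_mul (mul_right_J r ha) hb
    simpa [h2] using this
  have hq3 : q R ≤ 3 := by
    by_contra h
    have : q R ^ 3 ≤ _ := chain' 2 h2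
    have := Nat.pow_le_pow_left (show 4 ≤ q R by omega) 3
    omega
  obtain ⟨n, hn⟩ := red hq3 r
  set j := r - (n : R) with hj
  have e : a * r * b = a * j * b := by
    have : a * (n : R) * b = 0 := by
      rw [← (Int.cast_commute n a).eq, mul_assoc, hab, mul_zero]
    rw [hj, mul_sub, sub_mul, this, sub_zero]
  rw [e]
  have hm2 : ∀ {u v : R}, u ∈ J R → v ∈ J R → u * v ∈ (J R)^2 := by
    intro u v hu hv
    rw [pow_two]; exact Submodule.mul_mem_mul hu hv
  have hr : ∀ {k : ℕ} {u v : R}, u ∈ (J R)^k → v ∈ J R → u * v ∈ (J R)^(k+1) := by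
    intro k u v hu hv
    rw [pow_succ]; exact Submodule.mul_mem_mul hu hv
  have hl : ∀ {k : ℕ} {u v : R}, u ∈ J R → v ∈ (J R)^k → u * v ∈ (J R)^(k+1) := by
    intro k u v hu hv
    rw [pow_succ']; exact Submodule.mul_mem_mul hu hv
  by_contra hne
  have h3 : (J R)^3 ≠ ⊥ := by
    intro h
    have := hr (hm2 ha hn) hb
    rw [h] at this
    exact hne (by simpa using this)
  have h1 : (J R)^1 ≠ ⊥ := by
    intro h
    rw [pow_one] at h
    apply h3; rw [h]; simp [pow_succ]
  have hq : q R = 2 := by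
    have : q R ^ 4 ≤ _ := chain' 3 h3
    by_contra h
    have := Nat.pow_le_pow_left (show 3 ≤ q R by omega) 4
    omega
  have two : (2 : R) ∈ J R := by
    by_contra h
    obtain ⟨m, hm⟩ := red hq3 (2 : R)
    have h2 := AddSubgroup.nsmul_index_mem (J R).toAddSubgroup (1 : R)
    rw [show (J R).toAddSubgroup.index = 2 from hq] at h2
    exact h (by simpa using h2)
  have hi1 := idx_ge 1 le_rfl h5 h1
  have hi2 := idx_ge 2 (by norm_num) h5 h2
  have hi3 := idx_ge 3 (by norm_num) h5 h3
  have hc1 := card_step (R := R) 1 le_rfl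
  have hc2 := card_step (R := R) 2 (by norm_num)
  have hc3 := card_step (R := R) 3 (by norm_num)
  have hc0 : q R * Nat.card ↥((J R)^1).toAddSubgroup = Nat.card R := by
    rw [pow_one]; exact AddSubgroup.index_mul_card _
  rw [hq] at hc0
  norm_num only at hc1 hc2 hc3 hi1 hi2 hi3
  have c4pos : 0 < Nat.card ↥((J R)^4).toAddSubgroup := Nat.card_pos
  by_cases hcy : ((J R)^2).toAddSubgroup.relIndex ((J R)^1).toAddSubgroup ≤ 3
  · obtain ⟨x, hx, hx'⟩ := SetLike.not_le_iff_exists.1 (strict 1 le_rfl h5 h1)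
    have := comm_of_cyc x (by simpa using hx) hq3 h5
      (fun y hy => cyc _ _ hcy x hx hx' y (by simpa using hy)) a j
    rw [this, mul_assoc, hab, mul_zero] at hne
    exact hne rfl
  set i1 := ((J R)^2).toAddSubgroup.relIndex ((J R)^1).toAddSubgroup
  set i2 := ((J R)^3).toAddSubgroup.relIndex ((J R)^2).toAddSubgroup
  set i3 := ((J R)^4).toAddSubgroup.relIndex ((J R)^3).toAddSubgroup
  set c1 := Nat.card ↥((J R)^1).toAddSubgroup
  set c2 := Nat.card ↥((J R)^2).toAddSubgroup
  set c3 := Nat.card ↥((J R)^3).toAddSubgroup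
  set c4 := Nat.card ↥((J R)^4).toAddSubgroup with hc4
  have hc2' : c2 < 8 := by
    have : c2 * 4 ≤ c2 * i1 := Nat.mul_le_mul_left _ (by omega)
    omega
  have hc3' : c3 < 4 := by
    have : c3 * 2 ≤ c3 * i2 := Nat.mul_le_mul_left _ hi2
    omega
  have hc4' : c4 < 2 := by
    have : c4 * 2 ≤ c4 * i3 := Nat.mul_le_mul_left _ hi3
    omega
  have hc3'' : 2 ≤ c3 := by
    have : 1 * i3 ≤ c4 * i3 := Nat.mul_le_mul_right _ c4pos
    omega
  have hi2' : i2 ≤ 3 := by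
    have : 2 * i2 ≤ c3 * i2 := Nat.mul_le_mul_right _ hc3''
    omega
  have z4 : ∀ {u : R}, u ∈ (J R)^4 → u = 0 := by
    intro u hu
    have h : ((J R)^4).toAddSubgroup = ⊥ := AddSubgroup.eq_bot_of_card_eq _ (by omega)
    have : u ∈ ((J R)^4).toAddSubgroup := hu
    rw [h] at this
    simpa using this
  have dich : ∀ u v : R, u ∈ (J R)^2 → v ∈ (J R)^2 → u ∉ (J R)^3 → v ∉ (J R)^3 →
      u - v ∈ (J R)^3 := by
    intro u v hu hv hu' hv'
    obtain ⟨n, hn⟩ := cyc _ _ hi2' v hv hv' u hu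
    have hn : u - n • v ∈ (J R)^3 := hn
    have h2v : (2 : ℤ) • v ∈ (J R)^3 := by
      have := hl two hv
      rw [zsmul_eq_mul]; exact_mod_cast this
    rcases Int.even_or_odd' n with ⟨k, hk | hk⟩
    · exfalso; apply hu'
      have := Submodule.add_mem _ hn (Submodule.smul_mem _ k h2v)
      rw [hk, smul_smul, mul_comm k 2] at this
      simpa using this
    · have := Submodule.add_mem _ hn (Submodule.smul_mem _ k h2v)
      rw [hk, smul_smul, mul_comm k 2, add_smul, one_smul] at this
      convert this using 1
      abel
  have n1 : a * j ∉ (J R)^3 := fun h => hne (z4 (hr h hb))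
  have n2 : j * b ∉ (J R)^3 := fun h => hne (by rw [mul_assoc]; exact z4 (hl ha h))
  have d1 := z4 (hl ha (dich _ _ (hm2 ha hn) (hm2 hn hb) n1 n2))
  rw [mul_sub, sub_eq_zero] at d1
  have n3 : a * a ∉ (J R)^3 := fun h => hne (by
    rw [mul_assoc, ← d1, ← mul_assoc]; exact z4 (hr h hn))
  have d2 := z4 (hr (dich _ _ (hm2 ha ha) (hm2 ha hn) n3 n1) hb)
  rw [sub_mul, sub_eq_zero, mul_assoc, hab, mul_zero] at d2
  exact hne d2.symm

end
end SemiComm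

/-- Every finite local ring with fewer than 64 elements is semicommutative. -/
theorem finite_local_ring_of_order_lt_64_semicommutative (R : Type*) [Ring R]
    [Fintype R] [IsLocalRing R] (hcard : Fintype.card R < 64) :
    ∀ a b : R, a * b = 0 → ∀ r : R, a * r * b = 0 := by
  intro a b hab r
  exact SemiComm.main (by rwa [Nat.card_eq_fintype_card]) a b hab r
end

section
/- Every finite abelian ring (associative, with identity) with fewer than 64 elements is semicommutative: if R is a finite ring with card(R) < 64 in which every idempotent is central, then for all a, b ∈ R, ab = 0 implies arb = 0 for every r ∈ R. -/
theorem fa_card_aux {G ι : Type*} [AddCommGroup G] [Finite G] (A B : AddSubgroup G)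
    (hAB : A ≤ B) (t : ι → G) (ht : ∀ i, t i ∈ B) (hinj : ∀ i j, t i - t j ∈ A → i = j) :
    Nat.card ι * Nat.card A ≤ Nat.card B := by
  rw [← Nat.card_prod]
  refine Nat.card_le_card_of_injective
    (fun p : ι × A => (⟨t p.1 + p.2, B.add_mem (ht _) (hAB p.2.2)⟩ : B)) ?_
  rintro ⟨i, u⟩ ⟨j, v⟩ h
  have h1 : t i + (u : G) = t j + v := by simpa using h
  have h2 : t i - t j = (v : G) - u := by
    rw [sub_eq_sub_iff_add_eq_add, h1, add_comm]
  have h3 : i = j := hinj i j (h2 ▸ A.sub_mem v.2 u.2)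
  subst h3
  have h4 : u = v := by
    apply Subtype.ext
    simpa using h1
  rw [h4]

theorem fa_two {G : Type*} [AddCommGroup G] [Finite G] (A B : AddSubgroup G)
    (hAB : A ≤ B) (x : G) (hx : x ∈ B) (hxA : x ∉ A) :
    2 * Nat.card A ≤ Nat.card B := by
  have := fa_card_aux A B hAB (ι := Fin 2) ![0, x]
    (by intro i; fin_cases i <;> simp [hx])
    (by
      intro i j h
      fin_cases i <;> fin_cases j <;> simp_all)
  simpa using this

theorem fa_four {G : Type*} [AddCommGroup G] [Finite G] (A B : AddSubgroup G)
    (hAB : A ≤ B) (x y : G) (hx : x ∈ B) (hxA : x ∉ A) (hy : y ∈ B) (hyA : y ∉ A)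
    (hxy : x - y ∉ A) (hy2 : y + y ∈ A) :
    4 * Nat.card A ≤ Nat.card B := by
  have h1 : x + y ∉ A := fun h => hxy (by
    have := A.sub_mem h hy2
    rwa [show x + y - (y + y) = x - y by abel] at this)
  have h2 : y - x ∉ A := fun h => hxy (by
    have := A.neg_mem h
    rwa [neg_sub] at this)
  have h3 : -y - x ∉ A := fun h => h1 (by
    have := A.neg_mem h
    rwa [show -(-y - x) = x + y by abel] at this)
  have h4 : -y + -x ∉ A := by rwa [← sub_eq_add_neg]
  have := fa_card_aux A B hAB (ι := Fin 4) ![0, x, y, x + y]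
    (by intro i; fin_cases i <;> simp [hx, hy, B.add_mem])
    (by
      intro i j h
      fin_cases i <;> fin_cases j <;> first | rfl | (exfalso; simp_all))
  simpa using this

theorem fa_mul {R : Type*} [Ring R] (J : Ideal R) [J.IsTwoSided] {m n k : ℕ} (h : k = m + n)
    {x y : R} (hx : x ∈ J ^ m) (hy : y ∈ J ^ n) : x * y ∈ J ^ k := by
  rw [h, Ideal.IsTwoSided.pow_add]
  exact Ideal.mul_mem_mul hx hy

theorem fa_top {R : Type*} [Ring R] (J : Ideal R) [J.IsTwoSided]
    (N : ℕ) (hN : J ^ N = ⊥) (h2 : (2 : R) ∈ J) (hr : ∀ r : R, ∃ n : ℤ, r - n ∈ J)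
    (x : R) (hx : x ∈ J) (hy : ∀ y ∈ J, y ∈ J ^ 2 ∨ y - x ∈ J ^ 2)
    (S : Subring R) (hS : x ∈ S) (r : R) : r ∈ S := by
  have hxk : ∀ k, x ^ k ∈ J ^ k := fun k => by
    induction k with
    | zero => simp [Submodule.pow_zero]
    | succ k ih =>
      rw [pow_succ]
      exact fa_mul J rfl ih (by simpa [Submodule.pow_one] using hx)
  have hd : ∀ k, ∀ y ∈ J ^ k, y + y ∈ J ^ (k + 1) := fun k y hy => by
    rw [← two_mul]
    exact fa_mul J (add_comm _ _) (by simpa [Submodule.pow_one] using h2) hy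
  have key : ∀ k, ∀ y ∈ J ^ (k + 1), y ∈ J ^ (k + 2) ∨ y - x ^ (k + 1) ∈ J ^ (k + 2) := by
    intro k
    induction k with
    | zero => simpa [Submodule.pow_one] using hy
    | succ k ih =>
      intro y hyk
      rw [Ideal.IsTwoSided.pow_add (I := J) (k + 1) 1, Submodule.pow_one] at hyk
      refine Submodule.smul_induction_on hyk ?_ ?_
      · intro u hu v hv
        rw [smul_eq_mul]
        have hv1 : v ∈ J ^ 1 := by simpa [Submodule.pow_one] using hv
        rcases ih u hu with h | h
        · left; exact fa_mul J (by ring) h hv1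
        · rcases hy v hv with h' | h'
          · left; exact fa_mul J (by ring) hu h'
          · right
            have e : u * v - x ^ (k + 1 + 1) =
                (u - x ^ (k + 1)) * v + x ^ (k + 1) * (v - x) := by
              rw [pow_succ x (k + 1)]; noncomm_ring
            rw [e]
            exact add_mem (fa_mul J (by ring) h hv1) (fa_mul J (by ring) (hxk _) h')
      · intro u v hu hv
        rcases hu with hu | hu <;> rcases hv with hv | hv
        · left; exact add_mem hu hv
        · right; rw [add_sub_assoc]; exact add_mem hu hv
        · right; rw [add_sub_right_comm]; exact add_mem hu hv
        · left
          have := add_mem (add_mem hu hv) (hd _ _ (hxk (k + 1 + 1)))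
          convert this using 1
          abel
  have hSJ : ∀ m k, k + m = N → ∀ y ∈ J ^ (k + 1), y ∈ S := by
    intro m
    induction m with
    | zero =>
      intro k hk y hy
      have : y ∈ J ^ N := Ideal.pow_le_pow_right (by omega) hy
      rw [hN] at this
      rw [(Submodule.mem_bot R).1 this]; exact S.zero_mem
    | succ m ih =>
      intro k hk y hy
      rcases key k y hy with h | h
      · exact ih (k + 1) (by omega) y h
      · have := S.add_mem (ih (k + 1) (by omega) _ h) (S.pow_mem hS (k + 1))
        simpa using this
  obtain ⟨n, hn⟩ := hr r
  have := S.add_mem (hSJ N 0 (by simp) (r - n) (by simpa [Submodule.pow_one] using hn))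
    (intCast_mem S n)
  simpa using this

theorem fa_comm {R : Type*} [Ring R] (J : Ideal R) [J.IsTwoSided]
    (N : ℕ) (hN : J ^ N = ⊥) (h2 : (2 : R) ∈ J) (hr : ∀ r : R, ∃ n : ℤ, r - n ∈ J)
    (x : R) (hx : x ∈ J) (hy : ∀ y ∈ J, y ∈ J ^ 2 ∨ y - x ∈ J ^ 2)
    (r s : R) : r * s = s * r := by
  have h1 : x ∈ Subring.center R := by
    rw [Subring.mem_center_iff]
    intro g
    have := fa_top J N hN h2 hr x hx hy (Subring.centralizer {x})
      (by simp [Subring.mem_centralizer_iff]) g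
    simpa [Subring.mem_centralizer_iff, eq_comm] using this
  have := fa_top J N hN h2 hr x hx hy _ h1 s
  exact Subring.mem_center_iff.1 this r

theorem fa_local {R : Type*} [Ring R] [Finite R] [Nontrivial R] (hc : Nat.card R < 64)
    (J : Ideal R) [J.IsTwoSided] (hJ : ∀ x, x ∉ J → IsUnit x) (N : ℕ) (hN : J ^ N = ⊥)
    (a b : R) (hab : a * b = 0) (r : R) : a * r * b = 0 := by
  by_cases ha : a ∈ J
  swap
  · obtain ⟨u, rfl⟩ := hJ a ha
    have : b = 0 := by simpa using hab
    simp [this]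
  by_cases hb : b ∈ J
  swap
  · obtain ⟨u, rfl⟩ := hJ b hb
    have : a = 0 := by simpa using hab
    simp [this]
  have p1 : ∀ {x}, x ∈ J → x ∈ J ^ 1 := fun h => by simpa [Submodule.pow_one] using h
  have hJtop : (1 : R) ∉ J := by
    intro h
    rw [(Ideal.eq_top_iff_one J).2 h] at hN
    have h1 : ∀ n : ℕ, (1 : R) ∈ (⊤ : Ideal R) ^ n := fun n => by
      induction n with
      | zero => simp [Submodule.pow_zero]
      | succ n ih => rw [← one_mul (1 : R)]; exact fa_mul ⊤ rfl ih (by simp [Submodule.pow_one])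
    have := h1 N
    rw [hN] at this
    exact one_ne_zero ((Submodule.mem_bot R).1 this)
  set c : ℕ → ℕ := fun k => Nat.card (J ^ k).toAddSubgroup with hcdef
  set q := Nat.card (R ⧸ J) with hq
  have hle : ∀ k, (J ^ (k + 1)).toAddSubgroup ≤ (J ^ k).toAddSubgroup := fun k x hx =>
    Ideal.pow_le_pow_right (Nat.le_succ k) hx
  have hcpos : ∀ k, 1 ≤ c k := fun k => Nat.card_pos
  have hbig : ∀ k, J ^ k ≠ ⊥ → q * c (k + 1) ≤ c k := by
    intro k hk
    obtain ⟨x, hx, hx'⟩ : ∃ x ∈ J ^ k, x ∉ J ^ (k + 1) := by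
      by_contra! hcon
      have h1 : ∀ m, J ^ k ≤ J ^ (k + m) := by
        intro m
        induction m with
        | zero => exact le_rfl
        | succ m ih =>
          have : J ^ (k + 1) ≤ J ^ (k + (m + 1)) := by
            rw [Ideal.IsTwoSided.pow_add (I := J) k 1, ← add_assoc,
              Ideal.IsTwoSided.pow_add (I := J) (k + m) 1]
            exact Ideal.mul_mono ih le_rfl
          exact fun z hz => this (hcon z hz)
      exact hk (le_bot_iff.1 (hN ▸ (h1 N).trans (Ideal.pow_le_pow_right (by omega))))
    refine fa_card_aux _ _ (hle k) (fun i : R ⧸ J => (Quotient.out i) * x) ?_ ?_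
    · intro i; exact (J ^ k).mul_mem_left _ hx
    · intro i j hij
      have hij' : (Quotient.out i - Quotient.out j) * x ∈ J ^ (k + 1) := by
        rw [sub_mul]; exact hij
      have : Quotient.out i - Quotient.out j ∈ J := by
        by_contra hcon
        obtain ⟨u, hu⟩ := hJ _ hcon
        apply hx'
        rw [← hu] at hij'
        simpa using (J ^ (k + 1)).mul_mem_left (↑u⁻¹ : R) hij'
      have h2 := (Ideal.Quotient.eq (I := J)).2 this
      have h3 : ∀ i : R ⧸ J, Ideal.Quotient.mk J (Quotient.out i) = i := fun i =>
        Quotient.out_eq i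
      rwa [h3, h3] at h2
  have hc0 : c 0 ≤ Nat.card R := Nat.card_le_card_of_injective _ Subtype.val_injective
  have hb0 : q * c 1 ≤ c 0 := hbig 0 (by
    rw [Submodule.pow_zero]; intro h
    have : (1 : R) ∈ (1 : Ideal R) := by simp
    rw [h] at this
    exact one_ne_zero ((Submodule.mem_bot R).1 this))
  have hz : ∀ {k x}, J ^ k = ⊥ → x ∈ J ^ k → x = 0 := fun h hx => by
    rw [h] at hx; exact (Submodule.mem_bot R).1 hx
  by_cases hJ2 : J ^ 2 = ⊥
  · exact hz hJ2 (fa_mul J (m := 1) (n := 1) rfl (p1 (J.mul_mem_right _ ha)) (p1 hb))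
  have hJ1 : J ^ 1 ≠ ⊥ := fun h => hJ2 (le_bot_iff.1 (h ▸ Ideal.pow_le_pow_right (by omega)))
  have hb1 : q * c 2 ≤ c 1 := hbig 1 hJ1
  have hb2 : q * c 3 ≤ c 2 := hbig 2 hJ2
  have hnt : Nontrivial (R ⧸ J) :=
    ⟨0, 1, fun h => hJtop (by
      have := h.symm
      rwa [← map_one (Ideal.Quotient.mk J), Ideal.Quotient.eq_zero_iff_mem] at this)⟩
  have hfq : Finite (R ⧸ J) := Quotient.finite _
  have hq2 : 1 < q := Finite.one_lt_card
  have hp2 := hcpos 2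
  have hp3 := hcpos 3
  have hp4 := hcpos 4
  have hq4 : q < 4 := by
    by_contra! h
    have h2 : 4 ≤ c 2 := by nlinarith
    have h1 : 16 ≤ c 1 := by nlinarith
    have h0 : 64 ≤ c 0 := by nlinarith
    omega
  have hqp : q.Prime := by
    have : q = 2 ∨ q = 3 := by omega
    rcases this with h | h <;> rw [h] <;> norm_num
  have hr : ∀ r : R, ∃ n : ℤ, r - n ∈ J := by
    intro r
    have : Fact q.Prime := ⟨hqp⟩
    have : (Ideal.Quotient.mk J r) ∈ AddSubgroup.zmultiples (1 : R ⧸ J) :=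
      mem_zmultiples_of_prime_card (p := q) hq.symm one_ne_zero
    obtain ⟨n, hn⟩ := AddSubgroup.mem_zmultiples_iff.1 this
    refine ⟨n, ?_⟩
    rw [← Ideal.Quotient.eq, ← hn]
    simp
  obtain ⟨n, hn⟩ := hr r
  set j := r - n with hj
  have hrj : a * r * b = a * j * b := by
    rw [hj, mul_sub, sub_mul, ← Int.cast_comm, mul_assoc (n : R) a b, hab, mul_zero, sub_zero]
  rw [hrj]
  have m1 := p1 ha
  have m2 := p1 hb
  have m3 := p1 hn
  have tri : ∀ {k l m s : ℕ} {x y z : R}, s = k + l + m → J ^ s = ⊥ → x ∈ J ^ k → y ∈ J ^ l →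
      z ∈ J ^ m → x * y * z = 0 := fun h h0 hx hy hz' =>
    hz h0 (fa_mul J h (fa_mul J rfl hx hy) hz')
  by_cases hJ3 : J ^ 3 = ⊥
  · exact tri rfl hJ3 m1 m3 m2
  have hb3 : q * c 4 ≤ c 3 := hbig 3 hJ3
  have hqe : q = 2 := by
    by_contra hne
    have h3 : q = 3 := by omega
    rw [h3] at hb0 hb1 hb2 hb3
    omega
  have h2J : (2 : R) ∈ J := by
    rw [← Ideal.Quotient.eq_zero_iff_mem]
    have := card_nsmul_eq_zero' (x := (1 : R ⧸ J))
    rw [← hq, hqe] at this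
    rw [map_ofNat]
    simpa using this
  rw [hqe] at hb0 hb1 hb2 hb3
  have hd : ∀ k, ∀ y ∈ J ^ k, y + y ∈ J ^ (k + 1) := fun k y hy => by
    rw [← two_mul]
    exact fa_mul J (add_comm _ _) (p1 h2J) hy
  by_cases hgen : ∃ x ∈ J, ∀ y ∈ J, y ∈ J ^ 2 ∨ y - x ∈ J ^ 2
  · obtain ⟨x, hx, hy⟩ := hgen
    have hcm := fa_comm J N hN h2J hr x hx hy
    rw [hcm a j, mul_assoc, hab, mul_zero]
  push Not at hgen
  have hc1 : 4 * c 2 ≤ c 1 := by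
    obtain ⟨y, hy, hy', -⟩ := hgen 0 J.zero_mem
    obtain ⟨z, hz, hz', hzy⟩ := hgen y hy
    exact fa_four _ _ (hle 1) z y (p1 hz) hz' (p1 hy) hy' hzy (hd 1 y (p1 hy))
  have hJ4 : J ^ 4 = ⊥ := by
    by_contra hne
    have : q * c 5 ≤ c 4 := hbig 4 hne
    rw [hqe] at this
    have := hcpos 5
    omega
  have hc2 : ∀ x ∈ J ^ 2, ∀ y ∈ J ^ 2, x ∉ J ^ 3 → y ∉ J ^ 3 → x - y ∈ J ^ 3 := by
    intro x hx y hy hx' hy'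
    by_contra hne
    have : 4 * c 3 ≤ c 2 := fa_four _ _ (hle 2) x y hx hx' hy hy' hne (hd 2 y hy)
    omega
  by_cases ha2 : a ∈ J ^ 2
  · exact tri (by norm_num) hJ4 ha2 m3 m2
  by_cases hb2' : b ∈ J ^ 2
  · exact tri (by norm_num) hJ4 m1 m3 hb2'
  have haab : a * a * b = 0 := by rw [mul_assoc, hab, mul_zero]
  have habb : a * b * b = 0 := by rw [hab, zero_mul]
  by_cases hja : j - a ∈ J ^ 2
  · have := tri (by norm_num) hJ4 m1 hja m2
    rwa [mul_sub, sub_mul, haab, sub_zero] at this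
  by_cases hjb : j - b ∈ J ^ 2
  · have := tri (by norm_num) hJ4 m1 hjb m2
    rwa [mul_sub, sub_mul, habb, sub_zero] at this
  by_cases hj2 : j ∈ J ^ 2
  · exact tri (by norm_num) hJ4 m1 hj2 m2
  by_cases hjab : j - b - a ∈ J ^ 2
  · have := tri (by norm_num) hJ4 m1 hjab m2
    rwa [mul_sub, mul_sub, sub_mul, sub_mul, haab, habb, sub_zero, sub_zero] at this
  by_cases hba : b - a ∈ J ^ 2
  · have haa : a * a ∈ J ^ 3 := by
      have := fa_mul J (m := 1) (n := 2) rfl m1 hba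
      rw [mul_sub, hab, zero_sub] at this
      simpa using this
    have h0 : a * j * (b - a) = 0 := tri (by norm_num) hJ4 m1 m3 hba
    by_cases h1 : a * j ∈ J ^ 3
    · exact hz hJ4 (fa_mul J rfl h1 m2)
    have h5 : a * j * a = 0 := by
      by_cases h2 : j * a ∈ J ^ 3
      · rw [mul_assoc]; exact hz hJ4 (fa_mul J (m := 1) rfl m1 h2)
      have h3 := hc2 _ (fa_mul J (m := 1) (n := 1) rfl m3 m1) _
        (fa_mul J (m := 1) (n := 1) rfl m1 m3) h2 h1
      have h4 : a * (j * a - a * j) = 0 := hz hJ4 (fa_mul J (m := 1) rfl m1 h3)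
      have h6 : a * a * j = 0 := hz hJ4 (fa_mul J rfl haa m3)
      rw [mul_sub, ← mul_assoc, ← mul_assoc, h6, sub_zero] at h4
      exact h4
    rw [mul_sub, h5, sub_zero] at h0
    exact h0
  -- independent classes: contradiction with the cardinality
  exfalso
  have haa := hd 1 a m1
  let K : AddSubgroup R :=
    { carrier := {z | z ∈ J ^ 2 ∨ z - a ∈ J ^ 2}
      zero_mem' := Or.inl (zero_mem _)
      add_mem' := by
        rintro u v (hu | hu) (hv | hv)
        · left; exact add_mem hu hv
        · right; rw [add_sub_assoc]; exact add_mem hu hv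
        · right; rw [add_sub_right_comm]; exact add_mem hu hv
        · left
          have := add_mem (add_mem hu hv) haa
          convert this using 1
          abel
      neg_mem' := by
        rintro u (hu | hu)
        · left; exact neg_mem hu
        · right
          have := sub_mem (neg_mem hu) haa
          convert this using 1
          abel }
  have hK1 : (J ^ 2).toAddSubgroup ≤ K := fun z hz => Or.inl hz
  have hK2 : K ≤ (J ^ 1).toAddSubgroup := by
    rintro z (hz | hz)
    · exact hle 1 hz
    · have : z - a + a ∈ J ^ 1 := add_mem (hle 1 hz) m1
      rwa [sub_add_cancel] at this
  have e1 : 2 * c 2 ≤ Nat.card K := fa_two _ _ hK1 a (Or.inr (by simp)) ha2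
  have e2 : 4 * Nat.card K ≤ c 1 := fa_four _ _ hK2 j b m3 (not_or.2 ⟨hj2, hja⟩) m2
    (not_or.2 ⟨hb2', hba⟩) (not_or.2 ⟨hjb, hjab⟩) (Or.inl (hd 1 b m2))
  omega

theorem fa_pow_idem {R : Type*} [Ring R] [Finite R] (x : R) :
    ∃ n, 0 < n ∧ x ^ n * x ^ n = x ^ n := by
  obtain ⟨m, n, hmn, h⟩ : ∃ m n : ℕ, m < n ∧ x ^ m = x ^ n := by
    obtain ⟨m, n, hne, h⟩ := Finite.exists_ne_map_eq_of_infinite (fun n : ℕ => x ^ n)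
    rcases lt_or_gt_of_ne hne with h' | h'
    · exact ⟨m, n, h', h⟩
    · exact ⟨n, m, h', h.symm⟩
  obtain ⟨d, rfl⟩ := Nat.exists_eq_add_of_lt hmn
  have h1 : ∀ k l, x ^ (m + l + k * (d + 1)) = x ^ (m + l) := by
    intro k l
    induction k with
    | zero => simp
    | succ k ih =>
      rw [← ih, show m + l + (k + 1) * (d + 1) = (m + d + 1) + (l + k * (d + 1)) by ring, pow_add,
        ← h, ← pow_add, add_assoc]
  refine ⟨(m + 1) * (d + 1), by positivity, ?_⟩
  rw [← pow_add]
  have := h1 (m + 1) (m * d + d + 1)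
  rwa [show m + (m * d + d + 1) = (m + 1) * (d + 1) by ring] at this

theorem fa_noidem {R : Type*} [Ring R] [Finite R] [Nontrivial R] (hc : Nat.card R < 64)
    (hid : ∀ e : R, e * e = e → e = 0 ∨ e = 1)
    (a b : R) (hab : a * b = 0) (r : R) : a * r * b = 0 := by
  have hun : ∀ x : R, IsUnit x ∨ IsNilpotent x := by
    intro x
    obtain ⟨n, hn, h⟩ := fa_pow_idem x
    rcases hid _ h with h | h
    · exact Or.inr ⟨n, h⟩
    · left; exact IsUnit.of_pow_eq_one h hn.ne'
  obtain ⟨N, hN⟩ := IsSemiprimaryRing.isNilpotent (R := R)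
  refine fa_local hc (Ring.jacobson R) ?_ N hN a b hab r
  intro x hx
  by_contra hxu
  apply hx
  have hxn := (hun x).resolve_left hxu
  rw [← Ideal.jacobson_bot, Ideal.mem_jacobson_iff]
  intro y
  have hyx : IsNilpotent (y * x) := by
    refine (hun _).resolve_left ?_
    rintro ⟨u, hu⟩
    apply hxu
    have h1 : (↑u⁻¹ * y) * x = 1 := by rw [mul_assoc, ← hu]; simp
    exact IsUnit.of_mul_eq_one_right _ h1
  obtain ⟨u, hu⟩ := hyx.isUnit_one_add
  refine ⟨↑u⁻¹, ?_⟩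
  rw [Submodule.mem_bot, mul_assoc, ← mul_add_one, add_comm (y * x) 1, ← hu]
  simp

theorem fa_main (n : ℕ) : ∀ (R : Type*) [Ring R] [Finite R], Nat.card R = n → n < 64 →
    (∀ e : R, e * e = e → ∀ x : R, e * x = x * e) →
    ∀ a b : R, a * b = 0 → ∀ r : R, a * r * b = 0 := by
  induction n using Nat.strong_induction_on with
  | _ n ih =>
  intro R _ _ hn h64 hcen a b hab r
  rcases subsingleton_or_nontrivial R with hs | hnt
  · exact Subsingleton.elim _ _
  by_cases hid : ∀ e : R, e * e = e → e = 0 ∨ e = 1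
  · exact fa_noidem (hn ▸ h64) hid a b hab r
  push Not at hid
  obtain ⟨e, he, he0, he1⟩ := hid
  have key : ∀ f : R, f * f = f → f ≠ 1 → f * (a * r * b) = 0 := by
    intro f hf hf1
    have idem : IsIdempotentElem f := hf
    have hmem : ∀ x, f * x ∈ Subsemigroup.corner f := fun x => by
      rw [Subsemigroup.mem_corner_iff idem]
      constructor
      · rw [← mul_assoc, hf]
      · rw [mul_assoc, ← hcen f hf x, ← mul_assoc, hf]
    have hfm : ∀ x y, (f * x) * (f * y) = f * (x * y) := fun x y => by
      rw [hcen f hf x, mul_assoc, ← mul_assoc f f y, hf, ← mul_assoc, ← hcen f hf x, mul_assoc]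
    have hfin : Finite idem.Corner := Subtype.finite
    have hlt : Nat.card idem.Corner < n := by
      rw [← hn]
      refine Finite.card_subtype_lt (p := fun x => x ∈ Subsemigroup.corner f) (x := 1) ?_
      rw [Subsemigroup.mem_corner_iff idem]
      simp [hf1]
    have := ih _ hlt idem.Corner rfl (hlt.trans h64) (by
      intro g hg x
      have hg' : (g.1 : R) * g.1 = g.1 := congrArg Subtype.val hg
      exact Subtype.ext (hcen g.1 hg' x.1)) ⟨f * a, hmem a⟩ ⟨f * b, hmem b⟩
      (Subtype.ext (by
        change f * a * (f * b) = 0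
        rw [hfm, hab, mul_zero])) ⟨f * r, hmem r⟩
    have h2 : f * a * (f * r) * (f * b) = 0 := congrArg Subtype.val this
    rwa [hfm, hfm] at h2
  have h1 := key e he he1
  have h2 := key (1 - e) (by simp [mul_sub, sub_mul, he]) (by simpa using he0)
  rw [sub_mul, one_mul, h1, sub_zero] at h2
  exact h2

/-- Every finite abelian ring (all idempotents central) with fewer than 64
elements is semicommutative. -/
theorem finite_abelian_ring_of_order_lt_64_semicommutative (R : Type*) [Ring R]
    [Fintype R] (hcard : Fintype.card R < 64)
    (habelian : ∀ e : R, e * e = e → ∀ x : R, e * x = x * e) :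
    ∀ a b : R, a * b = 0 → ∀ r : R, a * r * b = 0 := by
  exact fa_main _ R rfl (by rwa [Nat.card_eq_fintype_card]) habelian
end

section
/- The ring U₂(F₂) of 2×2 upper triangular matrices over the field with two elements is a minimal NI nonabelian nonreflexive ring. That is: (i) U₂(F₂) has exactly 8 elements; (ii) the set of nilpotent elements of U₂(F₂) forms a two-sided ideal (U₂(F₂) is NI); (iii) U₂(F₂) has a noncentral idempotent (it is not abelian); (iv) U₂(F₂) is not reflexive (there exist a, b with arb = 0 for all r but bra ≠ 0 for some r); and (v) every ring with fewer than 8 elements is commutative, hence abelian. -/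
/-- The ring U₂(F₂) of 2×2 upper triangular matrices over `ZMod 2`. -/
def U₂F₂ : Subring (Matrix (Fin 2) (Fin 2) (ZMod 2)) where
  carrier := {M | M 1 0 = 0}
  zero_mem' := rfl
  one_mem' := by simp [Matrix.one_apply]
  add_mem' := by intro a b ha hb; simp_all [Set.mem_setOf_eq, Matrix.add_apply]
  neg_mem' := by intro a ha; simp_all [Set.mem_setOf_eq, Matrix.neg_apply]
  mul_mem' := by
    intro a b ha hb
    simp only [Set.mem_setOf_eq] at *
    simp [Matrix.mul_apply, Fin.sum_univ_succ, ha, hb]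

theorem nilp_iff_aux (a : U₂F₂) : IsNilpotent a ↔ (a.1 0 0 = 0 ∧ a.1 1 1 = 0) := by
  have ha : a.1 1 0 = 0 := a.2
  constructor
  · rintro ⟨n, hn⟩
    have key : ∀ k : ℕ, (a ^ k).1 0 0 = (a.1 0 0) ^ k ∧ (a ^ k).1 1 1 = (a.1 1 1) ^ k := by
      intro k
      induction k with
      | zero => simp
      | succ k ih =>
        have hk : (a ^ k).1 1 0 = 0 := (a ^ k).2
        rw [pow_succ, pow_succ, pow_succ, ← ih.1, ← ih.2]
        simp only [Subring.coe_mul, Matrix.mul_apply, Fin.sum_univ_two, ha, hk]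
        simp
    have h := key n
    rw [hn] at h
    exact ⟨eq_zero_of_pow_eq_zero h.1.symm, eq_zero_of_pow_eq_zero h.2.symm⟩
  · rintro ⟨h0, h1⟩
    refine ⟨2, ?_⟩
    apply Subtype.ext
    ext i j
    rw [pow_two, Subring.coe_mul, Matrix.mul_apply, Fin.sum_univ_two]
    fin_cases i <;> fin_cases j <;> simp [ha, h0, h1]

theorem two_mul_card_aux {G : Type*} [AddGroup G] [Finite G] {H K : AddSubgroup G} (h : H < K) :
    2 * Nat.card H ≤ Nat.card K := by
  obtain ⟨m, hm⟩ := AddSubgroup.card_dvd_of_le h.le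
  have hK : 0 < Nat.card K := Nat.card_pos
  have hne : Nat.card H ≠ Nat.card K := fun e =>
    h.ne (AddSubgroup.eq_of_le_of_card_ge h.le e.ge)
  rcases m with _ | _ | m
  · simp at hm; omega
  · simp at hm; omega
  · rw [hm]; nlinarith [Nat.zero_le (Nat.card H * m)]

theorem comm_aux (S : Type) [Ring S] [Fintype S] (hS : Fintype.card S < 8) (x y : S) :
    x * y = y * x := by
  by_contra hxy
  have hnt : (0 : S) ≠ 1 := by
    intro h
    haveI := subsingleton_of_zero_eq_one h
    exact hxy (Subsingleton.elim _ _)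
  let Z := (Subring.center S).toAddSubgroup
  let C := (Subring.centralizer {x}).toAddSubgroup
  have memZ : ∀ z : S, z ∈ Z ↔ ∀ g, g * z = z * g := fun z => Subring.mem_center_iff
  have memC : ∀ z : S, z ∈ C ↔ x * z = z * x := fun z => by
    have := @Subring.mem_centralizer_iff S _ {x} z
    rw [show z ∈ C ↔ z ∈ Subring.centralizer {x} from Iff.rfl, this]
    simp
  have h1 : (⊥ : AddSubgroup S) < Z := by
    refine lt_of_le_of_ne bot_le fun e => hnt ?_
    have : (1 : S) ∈ Z := (memZ 1).2 (by simp)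
    rw [← e] at this
    exact (AddSubgroup.mem_bot.1 this).symm
  have h2 : Z < C := by
    refine lt_of_le_of_ne (fun z hz => (memC z).2 ((memZ z).1 hz x)) fun e => hxy ?_
    have : x ∈ C := (memC x).2 rfl
    rw [← e] at this
    exact ((memZ x).1 this y).symm
  have h3 : C < ⊤ := by
    refine lt_of_le_of_ne le_top fun e => hxy ?_
    have : y ∈ C := by rw [e]; trivial
    exact (memC y).1 this
  have a1 := two_mul_card_aux h1
  have a2 := two_mul_card_aux h2
  have a3 := two_mul_card_aux h3
  rw [AddSubgroup.card_top, @Nat.card_eq_fintype_card S] at a3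
  rw [AddSubgroup.card_bot] at a1
  omega

def equiv_aux : U₂F₂ ≃ ZMod 2 × ZMod 2 × ZMod 2 where
  toFun a := (a.1 0 0, a.1 0 1, a.1 1 1)
  invFun p := ⟨!![p.1, p.2.1; 0, p.2.2], by change _ = _; simp⟩
  left_inv a := by
    have ha : a.1 1 0 = 0 := a.2
    apply Subtype.ext
    ext i j
    fin_cases i <;> fin_cases j <;> simp [ha]
  right_inv p := by simp

/-- U₂(F₂) is a minimal NI nonabelian nonreflexive ring:
(i) it has 8 elements; (ii) it is NI (its nilpotents form a two-sided ideal);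
(iii) it has a noncentral idempotent; (iv) it is not reflexive; and
(v) every ring with fewer than 8 elements is commutative, hence abelian. -/
theorem U2F2_minimal_NI_nonabelian_nonreflexive :
    Nat.card U₂F₂ = 8 ∧
    ((∀ a b : U₂F₂, IsNilpotent a → IsNilpotent b → IsNilpotent (a + b)) ∧
      (∀ r a : U₂F₂, IsNilpotent a → IsNilpotent (r * a) ∧ IsNilpotent (a * r))) ∧
    (∃ e : U₂F₂, e * e = e ∧ ∃ x : U₂F₂, e * x ≠ x * e) ∧
    (∃ a b : U₂F₂, (∀ r : U₂F₂, a * r * b = 0) ∧ ∃ r : U₂F₂, b * r * a ≠ 0) ∧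
    (∀ (S : Type) (_ : Ring S) (_ : Fintype S), Fintype.card S < 8 →
      ∀ x y : S, x * y = y * x) := by
  refine ⟨?_, ⟨?_, ?_⟩, ?_, ?_, ?_⟩
  · rw [Nat.card_congr equiv_aux]
    simp [Nat.card_prod]
  · intro a b ha hb
    rw [nilp_iff_aux] at *
    simp [ha, hb]
  · intro r a ha
    have h1 : a.1 1 0 = 0 := a.2
    have h2 : r.1 1 0 = 0 := r.2
    rw [nilp_iff_aux] at *
    rw [nilp_iff_aux]
    simp [Matrix.mul_apply, Fin.sum_univ_two, ha, h1, h2]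
  · refine ⟨⟨!![1, 0; 0, 0], by change _ = _; simp⟩, ?_, ⟨!![0, 1; 0, 0], by change _ = _; simp⟩, ?_⟩
    · apply Subtype.ext
      ext i j
      fin_cases i <;> fin_cases j <;> simp
    · intro h
      have := congrFun (congrFun (congrArg Subtype.val h) 0) 1
      simp at this
  · refine ⟨⟨!![0, 0; 0, 1], by change _ = _; simp⟩, ⟨!![1, 0; 0, 0], by change _ = _; simp⟩, ?_,
      ⟨!![0, 1; 0, 0], by change _ = _; simp⟩, ?_⟩
    · intro r
      have h2 : r.1 1 0 = 0 := r.2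
      apply Subtype.ext
      ext i j
      fin_cases i <;> fin_cases j <;> simp [Matrix.mul_apply, Matrix.vecMul, dotProduct, Fin.sum_univ_two, h2]
    · intro h
      have := congrFun (congrFun (congrArg Subtype.val h) 0) 1
      simp at this
  · intro S _ _ hS x y
    exact comm_aux S hS x y
end

section
/- Every ring (associative, with identity) that is both non-NI and nonreflexive has at least 128 elements; moreover the product ring M₂(F₂) × U₂(F₂) is such a ring of exactly 128 elements: it is not NI (its nilpotent elements do not form a two-sided ideal) and not reflexive (there exist a, b with arb = 0 for all r but bra ≠ 0 for some r). -/
theorem small_group {G : Type*} [AddCommGroup G] [Finite G] (h7 : Nat.card G ≤ 7) :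
    IsAddCyclic G ∨ (Nat.card G = 4 ∧ ∃ x y : G, ∀ z : G, z ∈ AddSubgroup.closure {x, y}) := by
  by_cases hc : IsAddCyclic G
  · exact Or.inl hc
  right
  have hpos : 0 < Nat.card G := Nat.card_pos
  have hp : ∀ p : ℕ, p.Prime → Nat.card G ≠ p := by
    intro p hp h
    have := Fact.mk hp
    exact hc (isAddCyclic_of_prime_card h)
  have h2 := hp 2 (by norm_num)
  have h3 := hp 3 (by norm_num)
  have h5 := hp 5 (by norm_num)
  have h7' := hp 7 (by norm_num)
  have h1 : Nat.card G ≠ 1 := by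
    intro h
    have := (Nat.card_eq_one_iff_unique.mp h).1
    exact hc inferInstance
  have h6 : Nat.card G ≠ 6 := by
    intro h
    have := Fact.mk Nat.prime_two
    have := Fact.mk Nat.prime_three
    obtain ⟨x, hx⟩ := exists_prime_addOrderOf_dvd_card' (G := G) 2 (by rw [h]; norm_num)
    obtain ⟨y, hy⟩ := exists_prime_addOrderOf_dvd_card' (G := G) 3 (by rw [h]; norm_num)
    have := (AddCommute.all x y).addOrderOf_add_eq_mul_addOrderOf_of_coprime
      (by rw [hx, hy]; norm_num)
    exact hc (isAddCyclic_of_addOrderOf_eq_card (x + y) (by rw [this, hx, hy, h]))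
  have h4 : Nat.card G = 4 := by omega
  refine ⟨h4, ?_⟩
  have : Nontrivial G := Finite.one_lt_card_iff_nontrivial.mp (by omega)
  obtain ⟨x, hx⟩ := exists_ne (0 : G)
  have hZ : ∃ y, y ∉ AddSubgroup.zmultiples x := by
    by_contra! h
    exact hc ⟨x, h⟩
  obtain ⟨y, hy⟩ := hZ
  refine ⟨x, y, ?_⟩
  have hlt : AddSubgroup.zmultiples x < AddSubgroup.closure {x, y} := by
    refine lt_of_le_of_ne ?_ ?_
    · rw [AddSubgroup.zmultiples_le]
      exact AddSubgroup.subset_closure (by simp)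
    · intro h
      exact hy (h ▸ AddSubgroup.subset_closure (by simp))
  have hd := AddSubgroup.card_addSubgroup_dvd_card (AddSubgroup.closure {x, y})
  have hZ1 : Nat.card (AddSubgroup.zmultiples x) ≠ 1 := by
    rw [Ne, AddSubgroup.card_eq_one, AddSubgroup.zmultiples_eq_bot]
    exact hx
  have hZ0 : 0 < Nat.card (AddSubgroup.zmultiples x) := Nat.card_pos
  have hcl : Nat.card (AddSubgroup.zmultiples x) < Nat.card (AddSubgroup.closure {x, y}) := 
    Set.ncard_lt_ncard (s := (AddSubgroup.zmultiples x : Set G)) hlt (Set.toFinite _)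
  have hfin : Nat.card (AddSubgroup.closure {x, y}) = Nat.card G := by
    have := Nat.le_of_dvd hpos hd
    rw [h4] at *
    interval_cases Nat.card (AddSubgroup.closure {x, y}) <;> omega
  rw [AddSubgroup.card_eq_iff_eq_top] at hfin
  intro z
  rw [hfin]
  trivial

/-- left identity -/
theorem left_id {R S : Type*} [Ring R] [Finite R] [Ring S] [IsSimpleRing S] (π : R →+* S)
    (hπ : Function.Surjective π) (hS : 16 ≤ Nat.card S) (hnc : ∃ s t : S, s * t ≠ t * s)
    (hI : Nat.card (π : R →+ S).ker ≤ 7) (hII : ∃ x y : R, π x = 0 ∧ π y = 0 ∧ x * y ≠ 0) :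
    ∃ e : R, π e = 0 ∧ ∀ x, π x = 0 → e * x = x := by
  by_cases hA : ∃ a : R, π a ≠ 0 ∧ ∀ x, π x = 0 → a * x = 0
  · obtain ⟨a, ha, hax⟩ := hA
    let J : TwoSidedIdeal S := TwoSidedIdeal.mk' {s | ∃ r, π r = s ∧ ∀ x, π x = 0 → r * x = 0}
      ⟨0, by simp⟩
      (by
        rintro _ _ ⟨r, rfl, hr⟩ ⟨r', rfl, hr'⟩
        exact ⟨r + r', by simp, fun x hx => by rw [add_mul, hr x hx, hr' x hx, add_zero]⟩)
      (by
        rintro _ ⟨r, rfl, hr⟩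
        exact ⟨-r, by simp, fun x hx => by rw [neg_mul, hr x hx, neg_zero]⟩)
      (by
        rintro s _ ⟨r, rfl, hr⟩
        obtain ⟨t, rfl⟩ := hπ s
        exact ⟨t * r, by simp, fun x hx => by rw [mul_assoc, hr x hx, mul_zero]⟩)
      (by
        rintro _ s ⟨r, rfl, hr⟩
        obtain ⟨t, rfl⟩ := hπ s
        exact ⟨r * t, by simp, fun x hx => by rw [mul_assoc, hr (t * x) (by simp [hx])]⟩)
    have h1 : (1 : S) ∈ J := by
      apply IsSimpleRing.one_mem_of_ne_zero_mem J ha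
      rw [TwoSidedIdeal.mem_mk']
      exact ⟨a, rfl, hax⟩
    rw [TwoSidedIdeal.mem_mk'] at h1
    obtain ⟨r, hr1, hr⟩ := h1
    refine ⟨1 - r, by simp [hr1], fun x hx => by rw [sub_mul, hr x hx, one_mul, sub_zero]⟩
  · exfalso
    push Not at hA
    have hA' : ∀ a : R, (∀ x, π x = 0 → a * x = 0) → π a = 0 := by
      intro a ha
      by_contra h
      obtain ⟨x, hx, hx'⟩ := hA a h
      exact hx' (ha x hx)
    clear hA
    rcases small_group hI with hc | ⟨h4, ⟨x, hx⟩, ⟨y, hy⟩, hxy⟩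
    · obtain ⟨⟨g, hg⟩, hgen⟩ := hc
      have hg0 : π g = 0 := hg
      have key : ∀ x, π x = 0 → ∃ n : ℤ, n • g = x := by
        intro x hx
        obtain ⟨n, hn⟩ := hgen ⟨x, hx⟩
        exact ⟨n, congrArg Subtype.val hn⟩
      obtain ⟨s, t, hst⟩ := hnc
      obtain ⟨r, rfl⟩ := hπ s
      obtain ⟨q, rfl⟩ := hπ t
      apply hst
      have := hA' (r * q - q * r) (by
        intro x hx
        obtain ⟨n, rfl⟩ := key x hx
        obtain ⟨a, ha⟩ := key (r * g) (by simp [hg0])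
        obtain ⟨b, hb⟩ := key (q * g) (by simp [hg0])
        have : (r * q - q * r) * g = 0 := by
          rw [sub_mul, mul_assoc, mul_assoc, ← ha, ← hb, mul_smul_comm, mul_smul_comm, ← ha, ← hb,
            smul_comm, sub_self]
        rw [mul_smul_comm, this, smul_zero])
      rwa [map_sub, map_mul, map_mul, sub_eq_zero] at this
    · have hx0 : π x = 0 := hx
      have hy0 : π y = 0 := hy
      let I := (π : R →+ S).ker
      let f : R →+ I × I :=
        { toFun := fun r => (⟨r * x, by change π _ = 0; simp [hx0]⟩,
            ⟨r * y, by change π _ = 0; simp [hy0]⟩)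
          map_zero' := by ext <;> simp
          map_add' := by intro a b; ext <;> simp [add_mul] }
      have hf : ∀ r, r ∈ f.ker → ∀ z, π z = 0 → r * z = 0 := by
        intro r hr z hz
        have h1 : r * x = 0 := congrArg (fun p => (p.1 : R)) hr
        have h2 : r * y = 0 := congrArg (fun p => (p.2 : R)) hr
        have := hxy ⟨z, hz⟩
        rw [AddSubgroup.mem_closure_pair] at this
        obtain ⟨m, n, h⟩ := this
        have h : m • x + n • y = z := congrArg Subtype.val h
        rw [← h, mul_add, mul_smul_comm, mul_smul_comm, h1, h2]; simp
      have hle : f.ker ≤ I := fun r hr => hA' r (hf r hr)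
      have c1 : Nat.card R = Nat.card (R ⧸ f.ker) * Nat.card f.ker :=
        AddSubgroup.card_eq_card_quotient_mul_card_addSubgroup _
      have c2 : Nat.card R = Nat.card (R ⧸ I) * Nat.card I :=
        AddSubgroup.card_eq_card_quotient_mul_card_addSubgroup _
      have c3 : Nat.card (R ⧸ I) = Nat.card S :=
        Nat.card_congr (QuotientAddGroup.quotientKerEquivOfSurjective (π : R →+ S) hπ).toEquiv
      have c4 : Nat.card (R ⧸ f.ker) ≤ 16 := by
        have := Nat.card_le_card_of_injective _ (QuotientAddGroup.kerLift_injective f)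
        rw [Nat.card_prod, h4] at this
        exact this
      have h4' : Nat.card I = 4 := h4
      have c5 : 4 ≤ Nat.card f.ker := by
        rw [c3, h4'] at c2
        nlinarith
      have hEq : f.ker = I := by
        apply AddSubgroup.eq_of_le_of_card_ge hle
        omega
      obtain ⟨u, v, hu, hv, huv⟩ := hII
      exact huv (hf u (by rw [hEq]; exact hu) v hv)

theorem bimod {R D : Type*} [Ring R] [Finite R] [DivisionRing D] {n : ℕ} (hn : 2 ≤ n)
    (π : R →+* Matrix (Fin n) (Fin n) D)
    (hπ : Function.Surjective π)
    (hI : Nat.card (π : R →+ Matrix (Fin n) (Fin n) D).ker ≤ 7)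
    (hII : ∀ x y : R, π x = 0 → π y = 0 → x * y = 0) : ∀ x, π x = 0 → x = 0 := by
  intro x hx
  by_contra hx0
  choose E hE using fun i j => hπ (Matrix.single i j (1 : D))
  have act : ∀ a b z, π a = π b → π z = 0 → a * z = b * z := by
    intro a b z hab hz
    have := hII (a - b) z (by simp [hab]) hz
    rwa [sub_mul, sub_eq_zero] at this
  have act' : ∀ a b z, π a = π b → π z = 0 → z * a = z * b := by
    intro a b z hab hz
    have := hII z (a - b) hz (by simp [hab])
    rwa [mul_sub, sub_eq_zero] at this
  have hsum : ∀ k, (∑ i, π (E i k * E k i)) = 1 := by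
    intro k
    simp only [map_mul, hE, Matrix.single_mul_single_same, mul_one]
    exact Matrix.sum_single_one
  have k0 : Fin n := ⟨0, by omega⟩
  obtain ⟨i, hi⟩ : ∃ i, E k0 i * x ≠ 0 := by
    by_contra! h
    apply hx0
    have := act 1 (∑ i, E i k0 * E k0 i) x (by rw [map_sum, hsum, map_one]) hx
    rw [one_mul] at this
    rw [this, Finset.sum_mul]
    exact Finset.sum_eq_zero fun i _ => by rw [mul_assoc, h, mul_zero]
  obtain ⟨j, hj⟩ : ∃ j, E k0 i * x * E j k0 ≠ 0 := by
    by_contra! h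
    apply hi
    have := act' 1 (∑ i, E i k0 * E k0 i) (E k0 i * x) (by rw [map_sum, hsum, map_one]) (by simp [hx])
    rw [mul_one] at this
    rw [this, Finset.mul_sum]
    exact Finset.sum_eq_zero fun i _ => by rw [← mul_assoc, h, zero_mul]
  set y := E k0 i * x * E j k0 with hy
  have hy0 : π y = 0 := by simp [hy, hx]
  have hyl : E k0 k0 * y = y := by
    rw [hy, ← mul_assoc, ← mul_assoc, mul_assoc (_ * _), act (E k0 k0 * E k0 i) (E k0 i) _ _ (by simp [hx]), mul_assoc]
    simp [hE]
  have hyr : y * E k0 k0 = y := by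
    rw [hy, mul_assoc, act' (E j k0 * E k0 k0) (E j k0) _ _ (by simp [hx])]
    simp [hE]
  let F : (Fin n → Fin n → Fin 2) → (π : R →+ Matrix (Fin n) (Fin n) D).ker := fun c =>
    ⟨∑ k, ∑ l, (c k l).val • (E k k0 * y * E k0 l), by change π _ = 0; simp [hy0]⟩
  have hF : ∀ c k l, E k0 k * (F c).1 * E l k0 = (c k l).val • y := by
    intro c k l
    have h1 : ∀ k' l', E k0 k * (E k' k0 * y * E k0 l') * E l k0 = 
        if k = k' ∧ l' = l then y else 0 := by
      intro k' l'
      have e1 : E k0 k * (E k' k0 * y * E k0 l') * E l k0 = 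
        (E k0 k * E k' k0) * y * (E k0 l' * E l k0) := by noncomm_ring
      rw [e1]
      split_ifs with h
      · obtain ⟨rfl, rfl⟩ := h
        rw [act _ (E k0 k0) y (by simp [hE]) hy0, hyl, act' _ (E k0 k0) y (by simp [hE]) hy0, hyr]
      · by_cases hk : k = k'
        · have hl : l' ≠ l := fun hl => h ⟨hk, hl⟩
          rw [act' _ 0 _ (by simp [hE, hl]) (by simp [hy0]), mul_zero]
        · rw [act _ 0 y (by simp [hE, hk]) hy0, zero_mul, zero_mul]
    simp only [F, Finset.mul_sum, Finset.sum_mul, mul_smul_comm, smul_mul_assoc, h1]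
    rw [Finset.sum_eq_single k, Finset.sum_eq_single l]
    · simp
    · intro b _ hb; simp [hb]
    · simp
    · intro b _ hb; simp [hb.symm]
    · simp
  have hinj : Function.Injective F := by
    intro c c' h
    funext k l
    have h1 := hF c k l
    rw [h, hF c' k l] at h1
    revert h1
    generalize c k l = a
    generalize c' k l = b
    fin_cases a <;> fin_cases b <;> simp [hj, Ne.symm hj]
  have := Nat.card_le_card_of_injective F hinj
  have h2 : 16 ≤ Nat.card (Fin n → Fin n → Fin 2) := by
    simp only [Nat.card_eq_fintype_card, Fintype.card_pi, Fintype.card_fin, Finset.prod_const,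
      Finset.card_univ]
    rw [← pow_mul]
    calc 16 = 2 ^ 4 := by norm_num
      _ ≤ _ := Nat.pow_le_pow_right (by norm_num) (by nlinarith)
  omega

theorem to_matrix {R : Type} [Ring R] [Finite R] 
    (h : ¬ ((∀ a b : R, IsNilpotent a → IsNilpotent b → IsNilpotent (a + b)) ∧
          (∀ r a : R, IsNilpotent a → IsNilpotent (r * a) ∧ IsNilpotent (a * r)))) :
    ∃ (n : ℕ) (D : Type) (_ : DivisionRing D) (π : R →+* Matrix (Fin n) (Fin n) D),
      2 ≤ n ∧ Function.Surjective π := by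
  obtain ⟨N, D, d, hD, hd, ⟨e⟩⟩ :=
    IsSemisimpleRing.exists_ringEquiv_pi_matrix_divisionRing (R ⧸ Ring.jacobson R)
  by_cases hex : ∃ i, 2 ≤ d i
  · obtain ⟨i, hi⟩ := hex
    refine ⟨d i, D i, hD i, (Pi.evalRingHom (fun i => Matrix (Fin (d i)) (Fin (d i)) (D i)) i).comp
      (e.toRingHom.comp (Ideal.Quotient.mk (Ring.jacobson R))),
      hi, ?_⟩
    exact (Function.surjective_eval i).comp (e.surjective.comp Ideal.Quotient.mk_surjective)
  · exfalso
    push Not at hex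
    have h1 : ∀ i, d i = 1 := fun i => by
      have := hex i
      have := (hd i).out
      omega
    have red : ∀ i, ∀ M : Matrix (Fin (d i)) (Fin (d i)) (D i), IsNilpotent M → M = 0 := by
      intro i
      rw [h1 i]
      intro M hM
      have hM' := hM.map (Matrix.uniqueRingEquiv (m := Fin 1) (A := D i)).toRingHom
      have h0 := hM'.eq_zero
      have h2 : M 0 0 = 0 := h0
      ext a b
      rw [Subsingleton.elim a 0, Subsingleton.elim b 0, h2]; rfl
    have nil : ∀ x : R, IsNilpotent x ↔ x ∈ Ring.jacobson R := by
      intro x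
      constructor
      · intro hx
        rw [← Ideal.Quotient.eq_zero_iff_mem]
        apply e.injective
        rw [map_zero]
        funext i
        apply red i
        exact ((hx.map (Ideal.Quotient.mk (Ring.jacobson R))).map e).map
          (Pi.evalRingHom (fun i => Matrix (Fin (d i)) (Fin (d i)) (D i)) i)
      · intro hx
        obtain ⟨k, hk⟩ := IsSemiprimaryRing.isNilpotent (R := R)
        refine ⟨k, ?_⟩
        have := Ideal.pow_mem_pow hx k
        rw [hk] at this
        simpa using this
    apply h
    simp only [nil]
    exact ⟨fun a b ha hb => add_mem ha hb,
      fun r a ha => ⟨Ideal.mul_mem_left _ r ha, Ideal.mul_mem_right r _ ha⟩⟩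

theorem matrix_card {D : Type*} [DivisionRing D] {n : ℕ} (hn : 2 ≤ n)
    [Finite (Matrix (Fin n) (Fin n) D)] : 16 ≤ Nat.card (Matrix (Fin n) (Fin n) D) := by
  let F : (Fin n → Fin n → Fin 2) → Matrix (Fin n) (Fin n) D :=
    fun c => Matrix.of fun i j => if c i j = 0 then 0 else 1
  have hinj : Function.Injective F := by
    intro c c' h
    funext k l
    have h1 := congrFun (congrFun h k) l
    simp only [F, Matrix.of_apply] at h1
    revert h1
    generalize c k l = a
    generalize c' k l = b
    fin_cases a <;> fin_cases b <;> simp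
  have := Nat.card_le_card_of_injective F hinj
  have h2 : 16 ≤ Nat.card (Fin n → Fin n → Fin 2) := by
    simp only [Nat.card_eq_fintype_card, Fintype.card_pi, Fintype.card_fin, Finset.prod_const,
      Finset.card_univ]
    rw [← pow_mul]
    calc 16 = 2 ^ 4 := by norm_num
      _ ≤ _ := Nat.pow_le_pow_right (by norm_num) (by nlinarith)
  omega

theorem small_comm {R S : Type*} [Ring R] [Finite R] [Ring S] (π : R →+* S)
    (hI : Nat.card (π : R →+ S).ker ≤ 7) (e : R) (he : π e = 0)
    (hel : ∀ x, π x = 0 → e * x = x) (her : ∀ x, π x = 0 → x * e = x)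
    (x y : R) (hx : π x = 0) (hy : π y = 0) : x * y = y * x := by
  by_contra hne
  have e0 : e ≠ 0 := by
    rintro rfl
    apply hne
    rw [← hel x hx, zero_mul, zero_mul, mul_zero]
  have hxe : e * x = x * e := by rw [hel x hx, her x hx]
  have hye : e * y = y * e := by rw [hel y hy, her y hy]
  let F : Fin 2 × Fin 2 × Fin 2 → (π : R →+ S).ker := fun c =>
    ⟨c.1.val • e + c.2.1.val • x + c.2.2.val • y, by change π _ = 0; simp [he, hx, hy]⟩
  have hinj : Function.Injective F := by
    rintro ⟨a, b, c⟩ ⟨a', b', c'⟩ h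
    have h : a.val • e + b.val • x + c.val • y = a'.val • e + b'.val • x + c'.val • y :=
      congrArg Subtype.val h
    have hc : c = c' := by
      by_contra hcc
      have hx2 : (a.val • e + b.val • x + c.val • y) * x
        = (a'.val • e + b'.val • x + c'.val • y) * x := by rw [h]
      have hx3 : x * (a.val • e + b.val • x + c.val • y)
        = x * (a'.val • e + b'.val • x + c'.val • y) := by rw [h]
      simp only [add_mul, mul_add, smul_mul_assoc, mul_smul_comm, hxe] at hx2 hx3
      apply hne
      clear h
      fin_cases c <;> fin_cases c' <;> simp at hcc hx2 hx3
      · rw [hx2] at hx3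
        have := hx3.symm
        grind
      · grind
    have hb : b = b' := by
      by_contra hcc
      have hx2 : (a.val • e + b.val • x + c.val • y) * y
        = (a'.val • e + b'.val • x + c'.val • y) * y := by rw [h]
      have hx3 : y * (a.val • e + b.val • x + c.val • y)
        = y * (a'.val • e + b'.val • x + c'.val • y) := by rw [h]
      simp only [add_mul, mul_add, smul_mul_assoc, mul_smul_comm, hye] at hx2 hx3
      apply hne
      clear h
      subst hc
      fin_cases b <;> fin_cases b' <;> simp at hcc hx2 hx3 <;> grind
    subst hc hb
    have ha : a = a' := by
      fin_cases a <;> fin_cases a' <;> simp [e0, Ne.symm e0] at h ⊢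
    rw [ha]
  have := Nat.card_le_card_of_injective F hinj
  simp at this
  simp at hI
  omega

theorem matrix_prime {D : Type*} [DivisionRing D] {n : ℕ} (A B : Matrix (Fin n) (Fin n) D)
    (h : ∀ M, A * M * B = 0) : A = 0 ∨ B = 0 := by
  by_contra! hh
  obtain ⟨hA, hB⟩ := hh
  obtain ⟨i, j, hij⟩ : ∃ i j, A i j ≠ 0 := by
    by_contra! hc
    exact hA (by ext i j; exact hc i j)
  obtain ⟨k, l, hkl⟩ : ∃ i j, B i j ≠ 0 := by
    by_contra! hc
    exact hB (by ext i j; exact hc i j)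
  have := congrFun (congrFun (h (Matrix.single j k 1)) i) l
  rw [mul_assoc, Matrix.mul_apply, Finset.sum_eq_single j] at this
  · simp [hij, hkl] at this
  · intro b _ hb
    simp [Matrix.single_mul_apply_of_ne, hb]
  · simp

theorem lower_bound (R : Type) [Ring R] [Finite R]
    (h1 : ¬ ((∀ a b : R, IsNilpotent a → IsNilpotent b → IsNilpotent (a + b)) ∧
          (∀ r a : R, IsNilpotent a → IsNilpotent (r * a) ∧ IsNilpotent (a * r))))
    (a b : R) (hab : ∀ r : R, a * r * b = 0) (hcard : Nat.card R < 128) (r : R) :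
    b * r * a = 0 := by
  obtain ⟨n, D, _, π, hn, hπ⟩ := to_matrix h1
  have : Finite (Matrix (Fin n) (Fin n) D) := Finite.of_surjective _ hπ
  have : NeZero n := ⟨by omega⟩
  have hS := matrix_card (D := D) hn
  have hI : Nat.card (π : R →+ Matrix (Fin n) (Fin n) D).ker ≤ 7 := by
    have c2 := AddSubgroup.card_eq_card_quotient_mul_card_addSubgroup
      (π : R →+ Matrix (Fin n) (Fin n) D).ker
    have c3 : Nat.card (R ⧸ (π : R →+ Matrix (Fin n) (Fin n) D).ker) = _ :=
        Nat.card_congr (QuotientAddGroup.quotientKerEquivOfSurjective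
          (π : R →+ Matrix (Fin n) (Fin n) D) hπ).toEquiv
    rw [c3] at c2
    by_contra! h
    nlinarith
  have hbra : π (b * r * a) = 0 := by
    rcases matrix_prime (π a) (π b) (by
      intro M
      obtain ⟨m, rfl⟩ := hπ M
      rw [← map_mul, ← map_mul, hab, map_zero]) with h | h <;> simp [h]
  by_cases hII : ∃ x y : R, π x = 0 ∧ π y = 0 ∧ x * y ≠ 0
  · have hnc : ∃ s t : Matrix (Fin n) (Fin n) D, s * t ≠ t * s := by
      let i : Fin n := ⟨0, by omega⟩
      let j : Fin n := ⟨1, by omega⟩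
      have hij : i ≠ j := by simp [i, j]
      refine ⟨Matrix.single i j 1, Matrix.single j i 1, fun h => ?_⟩
      have := congrFun (congrFun h i) i
      simp [hij, hij.symm] at this
    obtain ⟨e, he, hel⟩ := left_id π hπ hS hnc hI hII
    have : Finite Rᵐᵒᵖ := Finite.of_equiv R MulOpposite.opEquiv
    obtain ⟨f, hf, hfr⟩ := left_id (RingHom.op π)
      (fun s => by
        obtain ⟨r, hr⟩ := hπ s.unop
        exact ⟨MulOpposite.op r, by simp [hr]⟩)
      (by rwa [← Nat.card_congr MulOpposite.opEquiv])
      (by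
        obtain ⟨s, t, hst⟩ := hnc
        exact ⟨MulOpposite.op t, MulOpposite.op s, fun h => hst (MulOpposite.op_injective h)⟩)
      (by
        refine le_trans (Nat.card_le_card_of_injective
          (β := (π : R →+ Matrix (Fin n) (Fin n) D).ker)
          (fun x => ⟨x.1.unop, MulOpposite.op_injective x.2⟩) ?_) hI
        intro x y h
        exact Subtype.ext (MulOpposite.unop_injective (congrArg Subtype.val h)))
      (by
        obtain ⟨x, y, hx, hy, hxy⟩ := hII
        refine ⟨MulOpposite.op y, MulOpposite.op x, by simp [hy], by simp [hx], ?_⟩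
        exact fun h => hxy (MulOpposite.op_injective h))
    have hf' : π f.unop = 0 := MulOpposite.op_injective hf
    have hfr' : ∀ x, π x = 0 → x * f.unop = x := fun x hx =>
      MulOpposite.op_injective (hfr (MulOpposite.op x) (by simp [hx]))
    have hef : f.unop = e := by rw [← hfr' e he, hel _ hf']
    rw [hef] at hfr'
    have hcomm := small_comm π hI e he hel hfr'
    have cen : ∀ x, e * x = x * e := by
      intro x
      rw [← hfr' (e * x) (by simp [he]), ← hel (x * e) (by simp [he]), mul_assoc]
    have k : ∀ x y, e * (x * y) = e * (y * x) := by
      intro x y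
      have h := hcomm (e * x) (e * y) (by simp [he]) (by simp [he])
      have h3 : ∀ x y, e * x * (e * y) = e * (x * y) := by
        intro x y
        rw [cen x, mul_assoc, ← mul_assoc e e y, hel e he, ← mul_assoc, ← cen, mul_assoc]
      rwa [h3, h3] at h
    have hz : a * b = 0 := by
      have := hab 1
      rwa [mul_one] at this
    rw [← hel _ hbra, mul_assoc b, k, mul_assoc r, hz, mul_zero, mul_zero]
  · push Not at hII
    exact bimod hn π hπ hI hII _ hbra

theorem concrete :
    (Nat.card (Matrix (Fin 2) (Fin 2) (ZMod 2) × U₂F₂) = 128) ∧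
    ¬ ((∀ a b : Matrix (Fin 2) (Fin 2) (ZMod 2) × U₂F₂,
          IsNilpotent a → IsNilpotent b → IsNilpotent (a + b)) ∧
        (∀ r a : Matrix (Fin 2) (Fin 2) (ZMod 2) × U₂F₂,
          IsNilpotent a → IsNilpotent (r * a) ∧ IsNilpotent (a * r))) ∧
    (∃ a b : Matrix (Fin 2) (Fin 2) (ZMod 2) × U₂F₂,
        (∀ r : Matrix (Fin 2) (Fin 2) (ZMod 2) × U₂F₂, a * r * b = 0) ∧
        ∃ r : Matrix (Fin 2) (Fin 2) (ZMod 2) × U₂F₂, b * r * a ≠ 0) := by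
  refine ⟨?_, ?_, ?_⟩
  · have hM : Nat.card (Matrix (Fin 2) (Fin 2) (ZMod 2)) = 16 := by
      rw [← Nat.card_congr Matrix.of]
      simp [Nat.card_pi]
    have hU : Nat.card U₂F₂ = 8 := by
      let F : U₂F₂ ≃ ZMod 2 × ZMod 2 × ZMod 2 :=
        { toFun := fun M => (M.1 0 0, M.1 0 1, M.1 1 1)
          invFun := fun c => ⟨!![c.1, c.2.1; 0, c.2.2], by change _ = _; simp⟩
          left_inv := by
            rintro ⟨M, hM⟩
            have hM : M 1 0 = 0 := hM
            ext i j
            fin_cases i <;> fin_cases j <;> simp [hM]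
          right_inv := by
            rintro ⟨a, b, c⟩
            simp }
      rw [Nat.card_congr F]
      simp [ZMod.card]
    rw [Nat.card_prod, hM, hU]
  · rintro ⟨-, h⟩
    have h1 : IsNilpotent ((!![0, 1; 0, 0], 0) : Matrix (Fin 2) (Fin 2) (ZMod 2) × U₂F₂) :=
      ⟨2, by
        rw [pow_two]
        ext i j
        · fin_cases i <;> fin_cases j <;> simp
        · simp⟩
    obtain ⟨k, hk⟩ := (h (!![0, 0; 1, 0], 0) _ h1).1
    have hid : IsIdempotentElem (((!![0, 0; 1, 0], 0) : Matrix (Fin 2) (Fin 2) (ZMod 2) × U₂F₂)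
        * (!![0, 1; 0, 0], 0)) := by
      unfold IsIdempotentElem
      ext i j
      · fin_cases i <;> fin_cases j <;> simp
      · simp
    have h2 := hid.pow_succ_eq k
    rw [pow_succ, hk, zero_mul] at h2
    have := congrFun (congrFun (congrArg Prod.fst h2) 1) 1
    simp at this
  · refine ⟨(0, ⟨!![0, 0; 0, 1], by change _ = _; simp⟩),
      (0, ⟨!![1, 0; 0, 0], by change _ = _; simp⟩), ?_,
      (0, ⟨!![0, 1; 0, 0], by change _ = _; simp⟩), ?_⟩
    · rintro ⟨A, ⟨M, hM⟩⟩
      have hM : M 1 0 = 0 := hM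
      ext i j
      · simp
      · fin_cases i <;> fin_cases j <;>
          simp [Matrix.vecMul, dotProduct, Matrix.mul_apply, Fin.sum_univ_two, hM]
    · intro h
      have := congrFun (congrFun (congrArg (fun p => (p.2 : Matrix (Fin 2) (Fin 2) (ZMod 2))) h) 0) 1
      simp [Matrix.mul_apply] at this

/-- Every ring that is not NI (its nilpotents do not form a two-sided ideal) and
not reflexive has at least 128 elements; and M₂(F₂) × U₂(F₂) is such a ring with
exactly 128 elements. -/
theorem minimal_non_NI_nonreflexive :
    (∀ (R : Type) (_ : Ring R),
      ¬ ((∀ a b : R, IsNilpotent a → IsNilpotent b → IsNilpotent (a + b)) ∧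
          (∀ r a : R, IsNilpotent a → IsNilpotent (r * a) ∧ IsNilpotent (a * r))) →
      (∃ a b : R, (∀ r : R, a * r * b = 0) ∧ ∃ r : R, b * r * a ≠ 0) →
      128 ≤ Nat.card R ∨ Infinite R) ∧
    (Nat.card (Matrix (Fin 2) (Fin 2) (ZMod 2) × U₂F₂) = 128) ∧
    ¬ ((∀ a b : Matrix (Fin 2) (Fin 2) (ZMod 2) × U₂F₂,
          IsNilpotent a → IsNilpotent b → IsNilpotent (a + b)) ∧
        (∀ r a : Matrix (Fin 2) (Fin 2) (ZMod 2) × U₂F₂,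
          IsNilpotent a → IsNilpotent (r * a) ∧ IsNilpotent (a * r))) ∧
    (∃ a b : Matrix (Fin 2) (Fin 2) (ZMod 2) × U₂F₂,
        (∀ r : Matrix (Fin 2) (Fin 2) (ZMod 2) × U₂F₂, a * r * b = 0) ∧
        ∃ r : Matrix (Fin 2) (Fin 2) (ZMod 2) × U₂F₂, b * r * a ≠ 0) := by
  refine ⟨?_, concrete⟩
  rintro R _ h1 ⟨a, b, hab, r, hr⟩
  by_contra! h
  obtain ⟨h2, h3⟩ := h
  have : Finite R := by simpa using h3
  exact hr (lower_bound R h1 a b hab h2 r)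
end
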